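/- There exists a finite set S of 315 points in ℝ² and two points p, q ∈ S with dist(p,q) = 5/3, such that the unit-distance graph on S is 4-colorable and every proper 4-coloring c of this graph satisfies c p ≠ c q (i.e., {p,q} is a non-monochromatic pair at distance 5/3). -/

import Mathlib

set_option exponentiation.threshold 400

namespace UnitDistanceGraph

/-! ### A lattice in the plane

The quadruple `(i, j, k, l)` stands for the point `((a + b√33) / 12, (c√3 + d√11) / 12)`, where
`a`, `b`, `c`, `d` are the integers `coordA`, …, `coordD` below. -/

def coordA (v : ℤ × ℤ × ℤ × ℤ) : ℤ := v.1

def coordB (v : ℤ × ℤ × ℤ × ℤ) : ℤ := v.1 + 2 * v.2.1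

def coordC (v : ℤ × ℤ × ℤ × ℤ) : ℤ := v.1 + 2 * v.2.2.1

def coordD (v : ℤ × ℤ × ℤ × ℤ) : ℤ := 3 * v.1 - 2 * v.2.1 - 2 * v.2.2.1 + 4 * v.2.2.2

/-- The point of the plane with lattice coordinates `v`. -/
noncomputable def toPlane (v : ℤ × ℤ × ℤ × ℤ) : EuclideanSpace ℝ (Fin 2) :=
  !₂[(coordA v + coordB v * √33) / 12, (coordC v * √3 + coordD v * √11) / 12]

/-- The lattice vector `v` has length one. -/
def IsUnitVector (v : ℤ × ℤ × ℤ × ℤ) : Prop :=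
  coordA v ^ 2 + 33 * coordB v ^ 2 + 3 * coordC v ^ 2 + 11 * coordD v ^ 2 = 144 ∧
    coordA v * coordB v + coordC v * coordD v = 0

instance : DecidablePred IsUnitVector := fun v => by unfold IsUnitVector; infer_instance

theorem int_add_mul_sqrt_eq_zero {m n : ℤ} (h : (m : ℝ) + n * √33 = 0) : m = 0 ∧ n = 0 := by
  have irr : Irrational √33 := by norm_num
  have hn : n = 0 := by
    by_contra hn
    exact ((irr.intCast_mul hn).intCast_add m).ne_zero h
  subst hn
  simpa using h

theorem toPlane_injective : Function.Injective toPlane := by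
  rintro ⟨i, j, k, l⟩ ⟨i', j', k', l'⟩ h
  have h0 := congrArg (fun x : EuclideanSpace ℝ (Fin 2) => x 0) h
  have h1 := congrArg (fun x : EuclideanSpace ℝ (Fin 2) => x 1) h
  simp only [toPlane, coordA, coordB, coordC, coordD, PiLp.toLp_apply, Matrix.cons_val_zero,
    Matrix.cons_val_one, Matrix.cons_val_fin_one] at h0 h1
  have s : √33 = √3 * √11 := by rw [← Real.sqrt_mul (by norm_num)]; norm_num
  have s3 : √3 * √3 = 3 := Real.mul_self_sqrt (by norm_num)
  obtain ⟨hi, hj⟩ := int_add_mul_sqrt_eq_zero (m := i - i') (n := i + 2 * j - (i' + 2 * j'))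
    (by push_cast at h0 ⊢; linarith)
  obtain ⟨hk, hl⟩ := int_add_mul_sqrt_eq_zero (m := 3 * (i + 2 * k - (i' + 2 * k')))
    (n := 3 * i - 2 * j - 2 * k + 4 * l - (3 * i' - 2 * j' - 2 * k' + 4 * l'))
    (by push_cast at h1 ⊢; rw [s]; linear_combination 12 * √3 * h1 -
      (i + 2 * k - (i' + 2 * k') : ℝ) * s3)
  simp only [Prod.mk.injEq]
  omega

theorem dist_toPlane_sq (u v : ℤ × ℤ × ℤ × ℤ) :
    144 * dist (toPlane u) (toPlane v) ^ 2 =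
      ((coordA (u - v) ^ 2 + 33 * coordB (u - v) ^ 2 + 3 * coordC (u - v) ^ 2 +
        11 * coordD (u - v) ^ 2 : ℤ) : ℝ) +
      (2 * (coordA (u - v) * coordB (u - v) + coordC (u - v) * coordD (u - v)) : ℤ) * √33 := by
  have s : √33 = √3 * √11 := by rw [← Real.sqrt_mul (by norm_num)]; norm_num
  have s3 : √3 ^ 2 = 3 := Real.sq_sqrt (by norm_num)
  have s11 : √11 ^ 2 = 11 := Real.sq_sqrt (by norm_num)
  rw [EuclideanSpace.dist_eq, Real.sq_sqrt (by positivity)]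
  simp only [Fin.sum_univ_two, toPlane, coordA, coordB, coordC, coordD, PiLp.toLp_apply,
    Matrix.cons_val_zero, Matrix.cons_val_one, Matrix.cons_val_fin_one, Real.dist_eq, sq_abs,
    Prod.fst_sub, Prod.snd_sub, s]
  obtain ⟨i, j, k, l⟩ := u
  obtain ⟨i', j', k', l'⟩ := v
  push_cast
  linear_combination
    ((i - i' + 2 * (j - j')) ^ 2 * √11 ^ 2 + (i - i' + 2 * (k - k')) ^ 2 : ℝ) * s3 +
    (3 * (i - i' + 2 * (j - j')) ^ 2 +
      (3 * (i - i') - 2 * (j - j') - 2 * (k - k') + 4 * (l - l')) ^ 2 : ℝ) * s11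

theorem dist_toPlane_eq_one_iff (u v : ℤ × ℤ × ℤ × ℤ) :
    dist (toPlane u) (toPlane v) = 1 ↔ IsUnitVector (u - v) := by
  have key := dist_toPlane_sq u v
  constructor
  · intro h
    rw [h] at key
    obtain ⟨h1, h2⟩ := int_add_mul_sqrt_eq_zero
      (m := coordA (u - v) ^ 2 + 33 * coordB (u - v) ^ 2 + 3 * coordC (u - v) ^ 2 +
        11 * coordD (u - v) ^ 2 - 144)
      (n := 2 * (coordA (u - v) * coordB (u - v) + coordC (u - v) * coordD (u - v)))
      (by push_cast at key ⊢; linarith)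
    exact ⟨by omega, by omega⟩
  · rintro ⟨h1, h2⟩
    rw [h1, h2] at key
    have : dist (toPlane u) (toPlane v) ^ 2 = 1 := by push_cast at key; linarith
    exact (pow_eq_one_iff_of_nonneg dist_nonneg two_ne_zero).1 this

/-- No unit vector of the lattice has both `j` and `l` even. -/
theorem not_isUnitVector_of_even {v : ℤ × ℤ × ℤ × ℤ} (hj : Even v.2.1) (hl : Even v.2.2.2) :
    ¬ IsUnitVector v := by
  obtain ⟨i, j, k, l⟩ := v
  obtain ⟨j, rfl⟩ := hj
  obtain ⟨l, rfl⟩ := hl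
  rintro ⟨h1, h2⟩
  simp only [coordA, coordB, coordC, coordD] at h1 h2
  have h3 : i * i + i * k - k * k + 2 * (i * l - k * j + 2 * (k * l)) = 0 := by
    linarith
  have hi : Even i ∧ Even k := by
    have : Even (i * i + i * k - k * k) := ⟨-(i * l - k * j + 2 * (k * l)), by linarith⟩
    simp only [Int.even_add, Int.even_sub, Int.even_mul] at this
    tauto
  obtain ⟨⟨i, rfl⟩, ⟨k, rfl⟩⟩ := hi
  have h4 : i ^ 2 + 33 * (i + 2 * j) ^ 2 + 3 * (i + 2 * k) ^ 2 +
      11 * (3 * i - 2 * j - 2 * k + 4 * l) ^ 2 = 36 := by linarith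
  have h5 := congrArg (Int.cast : ℤ → ZMod 8) h4
  push_cast at h5
  revert h5
  generalize (i : ZMod 8) = i, (j : ZMod 8) = j, (k : ZMod 8) = k, (l : ZMod 8) = l
  decide +kernel +revert

/-! ### The graph -/

set_option maxHeartbeats 0 in
/-- Lattice coordinates of the 315 points. -/
def points : List (ℤ × ℤ × ℤ × ℤ) :=
  [(0, 16, 17, 40), (0, 16, 19, 41), (1, 15, 15, 38), (1, 15, 17, 39), (1, 15, 18, 39), (1, 15, 19,
  40), (1, 16, 16, 39), (1, 16, 17, 39), (1, 16, 18, 40), (3, 14, 17, 36), (3, 15, 16, 36), (4, 14,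
  14, 34), (4, 14, 15, 36), (4, 14, 16, 35), (4, 14, 17, 37), (4, 14, 18, 36), (6, 12, 12, 31), (6,
  12, 14, 32), (6, 12, 16, 33), (6, 12, 18, 34), (6, 13, 11, 31), (6, 13, 13, 32), (6, 13, 15, 33),
  (6, 13, 17, 34), (6, 13, 19, 35), (6, 14, 12, 32), (6, 14, 14, 33), (6, 14, 16, 34), (6, 14, 18,
  35), (7, 12, 13, 31), (7, 12, 14, 31), (7, 12, 15, 32), (7, 12, 16, 32), (7, 13, 13, 31), (7, 13,
  14, 32), (7, 13, 16, 33), (8, 11, 14, 30), (8, 12, 11, 29), (8, 12, 13, 30), (8, 12, 15, 31), (8,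
  12, 17, 32), (8, 13, 14, 31), (8, 13, 16, 32), (9, 11, 10, 28), (9, 11, 12, 29), (9, 11, 13, 28),
  (9, 11, 14, 30), (9, 11, 15, 29), (9, 11, 17, 30), (9, 12, 10, 27), (9, 12, 12, 28), (9, 12, 13,
  30), (9, 12, 14, 29), (9, 12, 15, 31), (9, 12, 16, 30), (9, 12, 17, 32), (10, 10, 11, 26), (10,
  10, 13, 27), (10, 11, 10, 26), (10, 11, 12, 27), (10, 11, 12, 28), (10, 11, 14, 28), (10, 11, 14,
  29), (10, 11, 16, 29), (10, 12, 13, 28), (10, 12, 15, 29), (11, 10, 10, 26), (11, 10, 11, 25),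
  (11, 10, 11, 26), (11, 10, 12, 26), (11, 10, 12, 27), (11, 10, 13, 26), (11, 10, 13, 27), (11, 10,
  14, 27), (11, 10, 14, 28), (11, 10, 15, 27), (11, 11, 10, 25), (11, 11, 11, 26), (11, 11, 11, 27),
  (11, 11, 12, 26), (11, 11, 13, 27), (11, 11, 13, 28), (11, 11, 14, 27), (11, 11, 14, 28), (11, 11,
  15, 29), (12, 9, 10, 24), (12, 9, 12, 25), (12, 9, 14, 26), (12, 10, 9, 24), (12, 10, 11, 25),
  (12, 10, 13, 26), (12, 10, 15, 27), (12, 11, 10, 25), (12, 11, 12, 26), (12, 11, 14, 27), (13, 9,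
  8, 22), (13, 9, 9, 23), (13, 9, 10, 23), (13, 9, 11, 24), (13, 9, 12, 24), (13, 9, 13, 25), (13,
  9, 14, 25), (13, 9, 15, 26), (13, 10, 8, 23), (13, 10, 9, 23), (13, 10, 10, 24), (13, 10, 11, 24),
  (13, 10, 12, 25), (13, 10, 13, 25), (13, 10, 14, 26), (13, 10, 15, 26), (14, 8, 8, 21), (14, 8,
  10, 22), (14, 8, 12, 23), (14, 8, 14, 24), (14, 9, 7, 21), (14, 9, 9, 22), (14, 9, 10, 22), (14,
  9, 10, 23), (14, 9, 11, 23), (14, 9, 12, 23), (14, 9, 12, 24), (14, 9, 13, 24), (14, 9, 15, 25),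
  (14, 10, 8, 22), (14, 10, 10, 23), (14, 10, 12, 24), (14, 10, 14, 25), (15, 8, 8, 21), (15, 8, 9,
  20), (15, 8, 10, 22), (15, 8, 11, 21), (15, 8, 12, 23), (15, 8, 13, 22), (15, 8, 14, 24), (15, 9,
  7, 21), (15, 9, 8, 20), (15, 9, 9, 22), (15, 9, 10, 21), (15, 9, 11, 23), (15, 9, 12, 22), (15, 9,
  13, 24), (16, 7, 7, 18), (16, 7, 7, 19), (16, 7, 9, 19), (16, 7, 9, 20), (16, 7, 11, 20), (16, 7,
  11, 21), (16, 7, 13, 21), (16, 7, 13, 22), (16, 8, 6, 18), (16, 8, 6, 19), (16, 8, 8, 19), (16, 8,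
  8, 20), (16, 8, 9, 21), (16, 8, 10, 20), (16, 8, 10, 21), (16, 8, 11, 22), (16, 8, 12, 21), (16,
  8, 12, 22), (16, 8, 14, 22), (16, 8, 14, 23), (16, 9, 7, 19), (16, 9, 7, 20), (16, 9, 9, 20), (16,
  9, 9, 21), (16, 9, 11, 21), (16, 9, 11, 22), (16, 9, 13, 22), (16, 9, 13, 23), (17, 7, 6, 18),
  (17, 7, 7, 17), (17, 7, 8, 19), (17, 7, 9, 18), (17, 7, 10, 20), (17, 7, 11, 19), (17, 7, 12, 21),
  (17, 8, 7, 19), (17, 8, 8, 18), (17, 8, 9, 20), (17, 8, 10, 19), (17, 8, 11, 21), (17, 8, 12, 20),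
  (17, 8, 13, 22), (18, 6, 6, 16), (18, 6, 8, 17), (18, 6, 10, 18), (18, 6, 12, 19), (18, 7, 5, 16),
  (18, 7, 7, 17), (18, 7, 8, 17), (18, 7, 8, 18), (18, 7, 9, 18), (18, 7, 10, 18), (18, 7, 10, 19),
  (18, 7, 11, 19), (18, 7, 13, 20), (18, 8, 6, 17), (18, 8, 8, 18), (18, 8, 10, 19), (18, 8, 12,
  20), (19, 6, 5, 15), (19, 6, 6, 15), (19, 6, 7, 16), (19, 6, 8, 16), (19, 6, 9, 17), (19, 6, 10,
  17), (19, 6, 11, 18), (19, 6, 12, 18), (19, 7, 5, 15), (19, 7, 6, 16), (19, 7, 7, 16), (19, 7, 8,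
  17), (19, 7, 9, 17), (19, 7, 10, 18), (19, 7, 11, 18), (19, 7, 12, 19), (20, 5, 6, 14), (20, 5, 8,
  15), (20, 5, 10, 16), (20, 6, 5, 14), (20, 6, 7, 15), (20, 6, 9, 16), (20, 6, 11, 17), (20, 7, 6,
  15), (20, 7, 8, 16), (20, 7, 10, 17), (21, 5, 5, 12), (21, 5, 6, 13), (21, 5, 6, 14), (21, 5, 7,
  13), (21, 5, 8, 14), (21, 5, 8, 15), (21, 5, 9, 14), (21, 5, 9, 15), (21, 5, 10, 16), (21, 6, 5,
  14), (21, 6, 6, 13), (21, 6, 6, 14), (21, 6, 7, 14), (21, 6, 7, 15), (21, 6, 8, 14), (21, 6, 8,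
  15), (21, 6, 9, 15), (21, 6, 9, 16), (21, 6, 10, 15), (22, 4, 7, 12), (22, 4, 9, 13), (22, 5, 4,
  11), (22, 5, 6, 12), (22, 5, 6, 13), (22, 5, 8, 13), (22, 5, 8, 14), (22, 5, 10, 14), (22, 6, 5,
  12), (22, 6, 7, 13), (22, 6, 7, 14), (23, 4, 3, 9), (23, 4, 5, 10), (23, 4, 6, 12), (23, 4, 7,
  11), (23, 4, 8, 13), (23, 4, 9, 12), (23, 4, 10, 14), (23, 5, 3, 11), (23, 5, 4, 10), (23, 5, 5,
  12), (23, 5, 6, 11), (23, 5, 7, 13), (23, 5, 8, 12), (23, 5, 10, 13), (24, 3, 6, 10), (24, 3, 8,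
  11), (24, 4, 3, 9), (24, 4, 5, 10), (24, 4, 7, 11), (24, 4, 9, 12), (24, 5, 6, 11), (25, 3, 4, 8),
  (25, 3, 5, 9), (25, 3, 6, 9), (25, 3, 7, 10), (25, 4, 4, 9), (25, 4, 5, 9), (25, 4, 6, 10), (25,
  4, 7, 10), (26, 2, 2, 6), (26, 2, 4, 7), (26, 2, 6, 8), (26, 2, 8, 9), (26, 3, 1, 6), (26, 3, 3,
  7), (26, 3, 5, 8), (26, 3, 7, 9), (26, 3, 9, 10), (26, 4, 2, 7), (26, 4, 4, 8), (26, 4, 6, 9),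
  (26, 4, 8, 10), (28, 2, 2, 4), (28, 2, 3, 6), (28, 2, 4, 5), (28, 2, 5, 7), (28, 2, 6, 6), (29, 1,
  3, 3), (29, 2, 4, 4), (31, 0, 1, 1), (31, 0, 2, 1), (31, 0, 3, 2), (31, 1, 0, 1), (31, 1, 2, 2),
  (31, 1, 3, 2), (31, 1, 4, 3), (32, 0, 1, 0), (32, 0, 3, 1)]

set_option maxHeartbeats 0 in
/-- Pairs of indices of points at unit distance. -/
def edges : List (ℕ × ℕ) :=
  [(0, 20), (0, 23), (0, 10), (0, 59), (0, 89), (0, 60), (1, 9), (1, 21), (1, 24), (1, 61), (1, 90),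
  (1, 62), (2, 31), (2, 11), (2, 6), (2, 22), (2, 66), (2, 96), (3, 16), (3, 13), (3, 69), (3, 6),
  (3, 8), (3, 23), (3, 70), (3, 12), (3, 98), (4, 19), (4, 21), (4, 71), (4, 7), (4, 72), (4, 99),
  (5, 17), (5, 29), (5, 15), (5, 73), (5, 8), (5, 24), (5, 14), (5, 74), (5, 100), (6, 11), (6, 20),
  (6, 12), (6, 35), (6, 77), (6, 105), (6, 27), (6, 78), (7, 23), (7, 25), (7, 79), (7, 106), (8,
  13), (8, 21), (8, 14), (8, 80), (8, 107), (8, 28), (8, 81), (9, 18), (9, 48), (9, 22), (9, 10),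
  (9, 131), (9, 99), (10, 22), (10, 49), (10, 54), (10, 26), (10, 106), (10, 138), (11, 29), (11,
  61), (11, 52), (11, 116), (11, 152), (12, 29), (12, 43), (12, 34), (12, 118), (12, 53), (12, 154),
  (13, 31), (13, 58), (13, 34), (13, 63), (13, 54), (13, 119), (13, 155), (14, 31), (14, 44), (14,
  35), (14, 121), (14, 55), (14, 157), (15, 45), (15, 59), (15, 35), (15, 122), (15, 158), (16, 86),
  (16, 43), (16, 142), (16, 20), (16, 184), (16, 21), (16, 69), (16, 143), (17, 87), (17, 45), (17,
  44), (17, 144), (17, 21), (17, 185), (17, 22), (17, 73), (17, 145), (18, 85), (18, 47), (18, 46),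
  (18, 146), (18, 68), (18, 22), (18, 186), (18, 23), (18, 147), (19, 86), (19, 48), (19, 72), (19,
  148), (19, 23), (19, 187), (19, 24), (19, 149), (20, 43), (20, 68), (20, 89), (20, 49), (20, 150),
  (20, 188), (20, 25), (20, 77), (20, 151), (21, 44), (21, 72), (21, 90), (21, 50), (21, 152), (21,
  25), (21, 189), (21, 26), (21, 80), (21, 153), (22, 45), (22, 46), (22, 88), (22, 91), (22, 52),
  (22, 51), (22, 155), (22, 26), (22, 192), (22, 27), (22, 156), (23, 47), (23, 69), (23, 89), (23,
  54), (23, 53), (23, 158), (23, 27), (23, 195), (23, 28), (23, 159), (24, 48), (24, 73), (24, 90),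
  (24, 55), (24, 83), (24, 160), (24, 28), (24, 196), (24, 161), (25, 49), (25, 93), (25, 162), (25,
  163), (25, 197), (26, 50), (26, 51), (26, 83), (26, 94), (26, 164), (26, 165), (26, 198), (27,
  52), (27, 53), (27, 77), (27, 92), (27, 166), (27, 167), (27, 199), (28, 54), (28, 55), (28, 80),
  (28, 93), (28, 168), (28, 169), (28, 200), (29, 56), (29, 100), (29, 59), (29, 34), (29, 90), (29,
  172), (29, 203), (30, 87), (30, 95), (30, 101), (30, 88), (30, 173), (30, 33), (30, 60), (30,
  204), (31, 57), (31, 85), (31, 96), (31, 102), (31, 61), (31, 34), (31, 35), (31, 91), (31, 174),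
  (31, 205), (32, 97), (32, 89), (32, 175), (32, 62), (32, 206), (33, 60), (33, 90), (33, 108), (33,
  178), (33, 211), (34, 59), (34, 88), (34, 103), (34, 109), (34, 64), (34, 212), (34, 94), (34,
  179), (35, 61), (35, 89), (35, 105), (35, 65), (35, 214), (35, 181), (36, 111), (36, 114), (36,
  71), (36, 70), (36, 38), (36, 96), (36, 218), (36, 39), (36, 101), (37, 66), (37, 98), (37, 119),
  (37, 76), (37, 106), (37, 220), (38, 67), (38, 70), (38, 95), (38, 100), (38, 115), (38, 122),
  (38, 79), (38, 190), (38, 103), (38, 108), (38, 78), (38, 191), (38, 221), (38, 41), (39, 71),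
  (39, 74), (39, 97), (39, 102), (39, 116), (39, 123), (39, 82), (39, 193), (39, 105), (39, 110),
  (39, 81), (39, 194), (39, 41), (39, 222), (39, 42), (40, 75), (40, 99), (40, 119), (40, 107), (40,
  84), (40, 42), (40, 223), (41, 79), (41, 104), (41, 81), (41, 109), (41, 124), (41, 127), (41,
  225), (42, 82), (42, 106), (42, 84), (42, 125), (42, 226), (43, 130), (43, 88), (43, 201), (43,
  118), (44, 85), (44, 132), (44, 89), (44, 203), (44, 229), (44, 51), (44, 121), (45, 86), (45,
  133), (45, 89), (45, 50), (45, 230), (45, 52), (45, 204), (46, 86), (46, 128), (46, 134), (46,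
  90), (46, 205), (46, 51), (46, 232), (46, 53), (47, 87), (47, 129), (47, 90), (47, 117), (47, 52),
  (47, 233), (47, 54), (47, 206), (48, 131), (48, 91), (48, 120), (48, 54), (48, 208), (49, 88),
  (49, 117), (49, 138), (49, 209), (50, 89), (50, 120), (50, 140), (50, 92), (50, 211), (50, 237),
  (51, 89), (51, 135), (51, 141), (51, 93), (51, 212), (51, 240), (52, 90), (52, 136), (52, 213),
  (52, 93), (52, 241), (53, 90), (53, 118), (53, 137), (53, 94), (53, 214), (53, 244), (54, 91),
  (54, 138), (54, 215), (54, 94), (54, 245), (55, 91), (55, 121), (55, 139), (55, 216), (56, 146),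
  (56, 131), (56, 217), (56, 96), (56, 58), (56, 59), (57, 142), (57, 148), (57, 133), (57, 98),
  (57, 218), (57, 59), (57, 246), (57, 61), (58, 96), (58, 103), (58, 155), (58, 138), (58, 220),
  (58, 248), (59, 98), (59, 150), (59, 105), (59, 158), (59, 64), (59, 140), (59, 221), (59, 249),
  (60, 97), (60, 132), (60, 151), (60, 106), (60, 159), (60, 221), (60, 135), (60, 250), (61, 129),
  (61, 100), (61, 152), (61, 107), (61, 160), (61, 64), (61, 65), (61, 222), (61, 251), (62, 99),
  (62, 134), (62, 153), (62, 108), (62, 161), (62, 137), (62, 222), (62, 252), (63, 131), (63, 102),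
  (63, 155), (63, 109), (63, 65), (63, 223), (63, 253), (64, 107), (64, 136), (64, 162), (64, 168),
  (64, 255), (64, 225), (65, 109), (65, 138), (65, 164), (65, 226), (66, 111), (66, 174), (66, 116),
  (66, 78), (66, 156), (67, 112), (67, 146), (67, 175), (67, 116), (67, 228), (67, 76), (67, 150),
  (67, 258), (67, 79), (68, 147), (68, 117), (68, 228), (68, 229), (68, 151), (69, 142), (69, 230),
  (69, 118), (69, 77), (69, 80), (69, 158), (70, 112), (70, 143), (70, 170), (70, 176), (70, 119),
  (70, 78), (70, 259), (70, 81), (70, 159), (71, 113), (71, 148), (71, 171), (71, 231), (71, 119),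
  (71, 152), (71, 79), (71, 260), (71, 82), (72, 149), (72, 120), (72, 231), (72, 232), (72, 153),
  (72, 83), (73, 144), (73, 233), (73, 234), (73, 121), (73, 80), (73, 160), (74, 113), (74, 145),
  (74, 172), (74, 122), (74, 234), (74, 81), (74, 154), (74, 261), (74, 84), (74, 161), (75, 114),
  (75, 173), (75, 122), (75, 155), (75, 82), (75, 262), (76, 116), (76, 155), (76, 180), (76, 124),
  (76, 265), (77, 118), (77, 150), (77, 237), (77, 166), (77, 238), (78, 116), (78, 151), (78, 157),
  (78, 181), (78, 125), (78, 238), (78, 167), (78, 266), (79, 119), (79, 158), (79, 182), (79, 162),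
  (79, 125), (79, 239), (79, 267), (80, 121), (80, 152), (80, 241), (80, 168), (80, 242), (81, 119),
  (81, 153), (81, 177), (81, 183), (81, 126), (81, 242), (81, 169), (81, 268), (82, 122), (82, 160),
  (82, 178), (82, 164), (82, 243), (82, 126), (82, 269), (83, 120), (83, 161), (83, 243), (83, 165),
  (83, 244), (84, 122), (84, 156), (84, 179), (84, 127), (85, 186), (85, 129), (85, 128), (85, 88),
  (85, 89), (86, 184), (86, 187), (86, 131), (86, 130), (86, 246), (86, 89), (86, 271), (86, 90),
  (87, 185), (87, 133), (87, 132), (87, 247), (87, 90), (87, 272), (87, 91), (88, 128), (88, 192),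
  (88, 136), (88, 135), (88, 248), (88, 273), (88, 92), (89, 129), (89, 130), (89, 188), (89, 195),
  (89, 138), (89, 137), (89, 249), (89, 92), (89, 274), (89, 93), (89, 250), (90, 131), (90, 132),
  (90, 189), (90, 196), (90, 140), (90, 139), (90, 251), (90, 93), (90, 275), (90, 94), (90, 252),
  (91, 133), (91, 134), (91, 192), (91, 141), (91, 253), (91, 94), (91, 276), (92, 136), (92, 137),
  (92, 199), (92, 254), (93, 138), (93, 139), (93, 197), (93, 200), (93, 255), (93, 256), (93, 277),
  (94, 140), (94, 141), (94, 198), (95, 143), (95, 185), (95, 204), (95, 257), (95, 104), (95, 190),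
  (95, 151), (96, 142), (96, 205), (96, 152), (96, 103), (96, 105), (96, 192), (97, 145), (97, 186),
  (97, 206), (97, 258), (97, 188), (97, 104), (97, 106), (97, 193), (97, 153), (97, 278), (98, 144),
  (98, 184), (98, 201), (98, 207), (98, 155), (98, 105), (98, 107), (98, 195), (98, 259), (98, 154),
  (98, 279), (99, 147), (99, 187), (99, 202), (99, 208), (99, 189), (99, 260), (99, 106), (99, 108),
  (99, 156), (99, 280), (100, 146), (100, 185), (100, 203), (100, 158), (100, 107), (100, 191),
  (100, 109), (100, 196), (100, 157), (100, 261), (100, 281), (101, 149), (101, 204), (101, 262),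
  (101, 108), (101, 192), (101, 110), (101, 159), (102, 148), (102, 186), (102, 205), (102, 160),
  (102, 109), (102, 194), (102, 263), (103, 150), (103, 191), (103, 212), (103, 162), (103, 198),
  (103, 264), (104, 153), (104, 192), (104, 213), (104, 163), (104, 265), (105, 152), (105, 188),
  (105, 154), (105, 194), (105, 214), (105, 164), (105, 282), (105, 199), (105, 266), (106, 156),
  (106, 195), (106, 209), (106, 215), (106, 165), (106, 197), (106, 267), (106, 283), (107, 155),
  (107, 189), (107, 157), (107, 210), (107, 216), (107, 166), (107, 284), (107, 200), (107, 268),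
  (108, 190), (108, 159), (108, 196), (108, 211), (108, 167), (108, 198), (108, 269), (108, 285),
  (109, 158), (109, 192), (109, 212), (109, 168), (110, 193), (110, 161), (110, 213), (110, 169),
  (110, 270), (110, 199), (111, 218), (111, 171), (111, 170), (111, 115), (111, 286), (111, 116),
  (111, 204), (112, 219), (112, 173), (112, 172), (112, 116), (112, 201), (112, 287), (112, 119),
  (112, 206), (113, 217), (113, 175), (113, 174), (113, 203), (113, 119), (113, 288), (113, 122),
  (113, 208), (114, 218), (114, 176), (114, 205), (114, 122), (114, 289), (114, 123), (115, 170),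
  (115, 203), (115, 221), (115, 211), (115, 290), (115, 124), (116, 171), (116, 172), (116, 205),
  (116, 222), (116, 178), (116, 213), (116, 177), (116, 124), (116, 291), (116, 125), (117, 206),
  (117, 209), (117, 274), (118, 201), (118, 274), (118, 214), (119, 173), (119, 174), (119, 202),
  (119, 207), (119, 220), (119, 223), (119, 180), (119, 210), (119, 215), (119, 179), (119, 125),
  (119, 292), (119, 126), (120, 208), (120, 211), (120, 275), (121, 203), (121, 275), (121, 216),
  (122, 175), (122, 176), (122, 204), (122, 221), (122, 182), (122, 212), (122, 181), (122, 126),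
  (122, 293), (122, 127), (123, 206), (123, 222), (123, 214), (123, 183), (123, 127), (123, 294),
  (124, 177), (124, 212), (124, 225), (124, 295), (125, 178), (125, 209), (125, 179), (125, 214),
  (125, 226), (125, 296), (126, 180), (126, 211), (126, 181), (126, 216), (126, 224), (126, 297),
  (127, 182), (127, 213), (127, 183), (127, 225), (127, 298), (128, 184), (128, 232), (128, 189),
  (128, 135), (128, 137), (129, 185), (129, 233), (129, 189), (129, 136), (129, 138), (129, 278),
  (130, 185), (130, 235), (130, 192), (130, 279), (130, 137), (130, 139), (131, 186), (131, 227),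
  (131, 192), (131, 138), (131, 140), (131, 280), (132, 186), (132, 229), (132, 195), (132, 281),
  (132, 139), (132, 141), (133, 187), (133, 230), (133, 195), (133, 140), (134, 187), (134, 232),
  (134, 196), (134, 141), (135, 188), (135, 240), (135, 197), (136, 189), (136, 241), (136, 197),
  (137, 189), (137, 244), (137, 198), (137, 282), (138, 192), (138, 245), (138, 198), (138, 283),
  (139, 192), (139, 236), (139, 199), (139, 284), (140, 195), (140, 237), (140, 285), (140, 199),
  (141, 195), (141, 240), (141, 200), (142, 246), (142, 230), (142, 286), (142, 201), (142, 150),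
  (142, 152), (143, 202), (143, 286), (143, 151), (143, 153), (144, 247), (144, 233), (144, 287),
  (144, 203), (144, 152), (144, 155), (145, 204), (145, 287), (145, 234), (145, 153), (145, 156),
  (146, 228), (146, 205), (146, 288), (146, 155), (146, 158), (147, 206), (147, 229), (147, 288),
  (147, 156), (147, 159), (148, 246), (148, 231), (148, 207), (148, 289), (148, 158), (148, 160),
  (149, 208), (149, 232), (149, 289), (149, 159), (149, 161), (150, 201), (150, 228), (150, 249),
  (150, 162), (150, 237), (150, 290), (151, 229), (151, 209), (151, 250), (151, 290), (151, 163),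
  (151, 238), (152, 203), (152, 231), (152, 210), (152, 251), (152, 162), (152, 164), (152, 241),
  (152, 291), (152, 299), (153, 202), (153, 232), (153, 211), (153, 252), (153, 291), (153, 163),
  (153, 165), (153, 242), (154, 203), (154, 212), (154, 244), (154, 300), (155, 227), (155, 205),
  (155, 248), (155, 212), (155, 253), (155, 164), (155, 166), (155, 245), (155, 292), (155, 301),
  (156, 204), (156, 235), (156, 213), (156, 236), (156, 292), (156, 165), (156, 167), (157, 205),
  (157, 229), (157, 214), (157, 302), (158, 230), (158, 207), (158, 249), (158, 214), (158, 166),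
  (158, 239), (158, 168), (158, 293), (158, 303), (159, 206), (159, 215), (159, 250), (159, 240),
  (159, 293), (159, 167), (159, 169), (160, 233), (160, 251), (160, 216), (160, 243), (160, 168),
  (160, 294), (161, 208), (161, 234), (161, 252), (161, 294), (161, 169), (161, 244), (162, 210),
  (162, 239), (162, 255), (162, 295), (163, 209), (163, 240), (163, 256), (163, 295), (164, 212),
  (164, 243), (164, 296), (165, 211), (165, 244), (165, 296), (166, 214), (166, 237), (166, 254),
  (166, 297), (167, 213), (167, 238), (167, 297), (168, 216), (168, 241), (168, 255), (168, 298),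
  (169, 215), (169, 242), (169, 256), (169, 298), (170, 259), (170, 220), (170, 177), (170, 250),
  (171, 217), (171, 246), (171, 260), (171, 220), (171, 178), (172, 217), (172, 261), (172, 221),
  (172, 177), (172, 179), (172, 252), (173, 218), (173, 247), (173, 257), (173, 262), (173, 221),
  (173, 178), (173, 248), (173, 304), (173, 180), (174, 218), (174, 263), (174, 222), (174, 179),
  (174, 181), (175, 219), (175, 258), (175, 222), (175, 249), (175, 180), (175, 182), (176, 219),
  (176, 259), (176, 223), (176, 181), (176, 183), (177, 220), (177, 268), (177, 224), (177, 256),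
  (178, 221), (178, 251), (178, 269), (178, 224), (179, 221), (179, 264), (179, 225), (180, 222),
  (180, 253), (180, 265), (180, 270), (180, 254), (180, 225), (180, 305), (181, 222), (181, 250),
  (181, 266), (181, 226), (182, 223), (182, 267), (182, 255), (182, 226), (183, 223), (183, 252),
  (183, 268), (184, 271), (184, 227), (184, 188), (184, 189), (185, 272), (185, 230), (185, 229),
  (185, 189), (185, 192), (186, 233), (186, 232), (186, 192), (186, 195), (187, 271), (187, 235),
  (187, 195), (187, 196), (188, 274), (188, 197), (189, 227), (189, 229), (189, 275), (189, 237),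
  (189, 236), (189, 299), (189, 197), (189, 198), (190, 257), (190, 238), (190, 269), (191, 228),
  (191, 261), (191, 239), (191, 264), (191, 300), (192, 230), (192, 232), (192, 273), (192, 276),
  (192, 241), (192, 240), (192, 301), (192, 198), (192, 199), (193, 234), (193, 258), (193, 242),
  (193, 270), (194, 231), (194, 263), (194, 243), (194, 266), (194, 302), (195, 233), (195, 235),
  (195, 274), (195, 245), (195, 244), (195, 303), (195, 199), (195, 200), (196, 275), (196, 200),
  (197, 236), (197, 277), (198, 237), (198, 240), (199, 241), (199, 244), (200, 245), (200, 277),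
  (201, 279), (201, 248), (201, 210), (201, 274), (202, 271), (202, 280), (202, 209), (202, 211),
  (203, 281), (203, 249), (203, 210), (203, 212), (203, 275), (203, 306), (204, 272), (204, 273),
  (204, 304), (204, 211), (204, 213), (204, 250), (204, 307), (205, 246), (205, 251), (205, 212),
  (205, 214), (205, 276), (205, 308), (206, 278), (206, 274), (206, 213), (206, 215), (206, 252),
  (207, 247), (207, 271), (207, 279), (207, 253), (207, 214), (207, 216), (208, 280), (208, 215),
  (208, 275), (209, 274), (209, 283), (210, 248), (210, 284), (210, 254), (210, 309), (210, 277),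
  (211, 250), (211, 275), (211, 285), (212, 249), (212, 273), (212, 255), (212, 310), (213, 252),
  (213, 276), (213, 256), (213, 305), (213, 311), (214, 251), (214, 274), (214, 282), (214, 312),
  (215, 283), (215, 277), (216, 253), (216, 275), (216, 284), (217, 288), (217, 258), (217, 220),
  (217, 221), (217, 280), (218, 286), (218, 289), (218, 260), (218, 259), (218, 221), (218, 222),
  (219, 287), (219, 262), (219, 261), (219, 279), (219, 222), (219, 223), (220, 257), (220, 279),
  (220, 292), (220, 265), (220, 283), (220, 264), (220, 224), (221, 258), (221, 259), (221, 281),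
  (221, 290), (221, 293), (221, 267), (221, 285), (221, 266), (221, 224), (221, 313), (221, 225),
  (222, 260), (222, 261), (222, 278), (222, 291), (222, 294), (222, 269), (222, 282), (222, 268),
  (222, 225), (222, 314), (222, 226), (223, 262), (223, 263), (223, 280), (223, 292), (223, 270),
  (223, 284), (223, 226), (224, 265), (224, 266), (224, 284), (224, 297), (225, 267), (225, 268),
  (225, 295), (225, 298), (226, 269), (226, 283), (226, 296), (227, 273), (227, 237), (228, 288),
  (228, 290), (228, 239), (228, 306), (229, 274), (229, 306), (229, 236), (229, 240), (230, 271),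
  (230, 274), (230, 237), (230, 241), (230, 307), (231, 289), (231, 291), (231, 239), (231, 243),
  (231, 308), (232, 271), (232, 275), (232, 308), (232, 240), (232, 244), (233, 272), (233, 275),
  (233, 241), (233, 245), (234, 287), (234, 242), (234, 294), (235, 272), (235, 276), (235, 244),
  (236, 273), (236, 309), (237, 274), (238, 290), (238, 297), (239, 293), (239, 310), (239, 295),
  (240, 274), (240, 277), (240, 310), (241, 275), (241, 311), (241, 277), (242, 291), (242, 311),
  (242, 298), (243, 294), (243, 312), (243, 296), (244, 275), (244, 312), (245, 276), (246, 279),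
  (246, 249), (246, 251), (247, 281), (247, 251), (247, 253), (248, 301), (248, 254), (249, 279),
  (249, 282), (249, 303), (249, 254), (249, 255), (249, 313), (250, 278), (250, 283), (250, 313),
  (250, 256), (251, 281), (251, 299), (251, 284), (251, 255), (251, 314), (252, 280), (252, 285),
  (252, 314), (252, 256), (253, 301), (254, 282), (255, 284), (256, 283), (257, 286), (257, 304),
  (257, 290), (257, 265), (258, 287), (258, 291), (258, 265), (258, 267), (259, 287), (259, 292),
  (259, 266), (259, 268), (260, 288), (260, 292), (260, 299), (260, 267), (260, 269), (261, 288),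
  (261, 293), (261, 268), (261, 300), (262, 289), (262, 304), (262, 293), (262, 301), (262, 269),
  (262, 270), (263, 289), (263, 294), (263, 302), (264, 290), (264, 300), (264, 295), (265, 291),
  (265, 301), (265, 305), (265, 295), (266, 291), (266, 302), (266, 296), (267, 292), (267, 303),
  (267, 296), (268, 292), (268, 297), (269, 293), (269, 297), (270, 294), (270, 305), (270, 298),
  (271, 274), (271, 275), (272, 275), (272, 276), (274, 277), (275, 277), (278, 283), (279, 301),
  (279, 282), (279, 284), (279, 300), (280, 283), (280, 285), (281, 306), (281, 303), (281, 284),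
  (281, 302), (282, 299), (282, 300), (282, 312), (284, 301), (284, 302), (284, 309), (286, 290),
  (286, 291), (286, 307), (287, 304), (287, 291), (287, 292), (288, 306), (288, 292), (288, 293),
  (289, 308), (289, 293), (289, 294), (290, 306), (290, 313), (290, 295), (291, 308), (291, 314),
  (291, 311), (291, 295), (291, 296), (292, 304), (292, 305), (292, 309), (292, 296), (292, 297),
  (293, 307), (293, 313), (293, 310), (293, 297), (293, 298), (294, 314), (294, 312), (294, 298),
  (295, 310), (296, 312), (297, 305), (298, 311), (299, 306), (299, 309), (300, 306), (300, 310),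
  (301, 308), (301, 310), (302, 308), (302, 312), (303, 312), (304, 313), (304, 305), (305, 314),
  (306, 309), (306, 310), (307, 311), (308, 310), (308, 312)]

def Adj (u v : ℕ) : Prop := (u, v) ∈ edges ∨ (v, u) ∈ edges

theorem lt_of_mem_edges : ∀ e ∈ edges, e.1 < 315 ∧ e.2 < 315 := by decide +kernel

/-! ### Bit sets

Sets of vertices are stored as bits of natural numbers. The functions are written with the
operations that the kernel evaluates natively and with raw recursors. -/

/-- The position of the row of `v` in `adjBits`; `2` is a primitive root modulo `317`. -/
noncomputable def slot (v : ℕ) : ℕ := Nat.mul 315 (Nat.mod (Nat.pow 2 v) 317)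

/-- The adjacency matrix, as one number. -/
noncomputable def adjBits : ℕ :=
  edges.foldr (fun e r => Nat.lor r (Nat.lor (Nat.shiftLeft 1 (Nat.add (slot e.1) e.2))
    (Nat.shiftLeft 1 (Nat.add (slot e.2) e.1)))) 0

noncomputable def allBits : ℕ := Nat.sub (Nat.pow 2 315) 1

noncomputable def row (s : ℕ) : ℕ := Nat.land (Nat.shiftRight adjBits (Nat.mul 315 s)) allBits

/-- `k n`, with `n` evaluated first. -/
noncomputable def force {α : Type} (n : ℕ) (k : ℕ → α) : α :=
  Nat.rec (k 0) (fun m _ => k (Nat.succ m)) n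

/-- The union of `acc` and of the neighbourhoods of the elements of `P`. -/
noncomputable def neighbors (fuel : ℕ) : ℕ → ℕ → ℕ :=
  Nat.rec (fun _ acc => acc) (fun _ ih P acc =>
    Bool.rec
      ((fun Q => force (Nat.mod (Nat.xor P Q) 317) (fun s => ih Q (Nat.lor acc (row s))))
        (Nat.land P (Nat.sub P 1)))
      acc (Nat.beq P 0)) fuel

/-- Remove from `D` the neighbours of the elements of `S` that lie in `D`. -/
noncomputable def update (D S : ℕ) : ℕ :=
  Nat.xor D (Nat.land D (neighbors 315 (Nat.land S D) 0))

/-- `x` if `b` is false, and `y` otherwise. -/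
noncomputable def select (b x y : Bool) : Bool := Bool.rec x y b

/-- One round of `propagate`, for the set `S` of vertices whose colour has just been decided. -/
noncomputable def propagateStep (ih k : ℕ → ℕ → ℕ → ℕ → ℕ → Bool) (a b c d e S : ℕ) : Bool :=
  select (Nat.beq S 0) (ih (update a S) (update b S) (update c S) (update d S) (Nat.lor e S))
    (k a b c d e)

/-- Unit propagation: `a`, `b`, `c`, `d` are the sets of vertices that may still receive the
colours `0`, `1`, `2`, `3`, and `e` is the set of vertices already processed. The value is `true`
if some vertex runs out of colours, and is computed by `k` once nothing is left to propagate. -/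
noncomputable def propagate (k : ℕ → ℕ → ℕ → ℕ → ℕ → Bool) (fuel : ℕ) :
    ℕ → ℕ → ℕ → ℕ → ℕ → Bool :=
  Nat.rec (fun _ _ _ _ _ => false) (fun _ ih a b c d e =>
    select (Nat.beq (Nat.lor (Nat.lor a b) (Nat.lor c d)) allBits) true
      (propagateStep ih k a b c d e
        (Nat.xor allBits (Nat.lor e (Nat.lor (Nat.land (Nat.lor a b) (Nat.lor c d))
          (Nat.lor (Nat.land a b) (Nat.land c d))))))) fuel

noncomputable def erase (i a : ℕ) : ℕ := Nat.xor a (Nat.land a i)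

noncomputable def disjointOr (i a : ℕ) (k : Bool) : Bool :=
  Bool.rec k true (Nat.beq (Nat.land a i) 0)

noncomputable def andThen (a b : Bool) : Bool := Bool.rec false b a

/-- A search tree: `b v t₀ t₁ t₂ t₃` branches on the colour of `v`, and `x` is a leaf. -/
inductive SearchTree
  | x
  | b (v : ℕ) (t₀ t₁ t₂ t₃ : SearchTree)

/-- The search tree shows that no colouring is compatible with the given state. -/
noncomputable def refutes (t : SearchTree) : ℕ → ℕ → ℕ → ℕ → ℕ → Bool :=
  SearchTree.rec (propagate (fun _ _ _ _ _ => false) 100)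
    (fun v _ _ _ _ r₀ r₁ r₂ r₃ => propagate (fun a b c d e =>
      (fun i => andThen (Nat.ble v 314)
        (andThen (disjointOr i a (r₀ a (erase i b) (erase i c) (erase i d) e))
        (andThen (disjointOr i b (r₁ (erase i a) b (erase i c) (erase i d) e))
        (andThen (disjointOr i c (r₂ (erase i a) (erase i b) c (erase i d) e))
          (disjointOr i d (r₃ (erase i a) (erase i b) (erase i c) d e))))))
      (Nat.shiftLeft 1 v)) 100) t

/-- The vertices that may receive colour `k` given the colours of the vertices in `l`. -/
noncomputable def initial (l : List (ℕ × ℕ)) (k : ℕ) : ℕ :=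
  l.foldr (fun p D => Bool.rec (erase (Nat.shiftLeft 1 p.1) D) D (Nat.beq p.2 k)) allBits

noncomputable def refutesFrom (l : List (ℕ × ℕ)) (t : SearchTree) : Bool :=
  refutes t (initial l 0) (initial l 1) (initial l 2) (initial l 3) 0

/-! ### Soundness -/

theorem testBit_allBits (v : ℕ) : allBits.testBit v = decide (v < 315) :=
  Nat.testBit_two_pow_sub_one 315 v

theorem allBits_lt : allBits < 2 ^ 315 := by
  show 2 ^ 315 - 1 < 2 ^ 315
  omega

theorem eq_allBits {D : ℕ} (hD : D < 2 ^ 315) (h : ∀ v < 315, D.testBit v = true) :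
    D = allBits := by
  refine Nat.eq_of_testBit_eq fun v => ?_
  rw [testBit_allBits]
  by_cases hv : v < 315
  · simp [hv, h v hv]
  · simpa [hv] using Nat.testBit_lt_two_pow (hD.trans_le (Nat.pow_le_pow_right two_pos (not_lt.1 hv)))

theorem testBit_erase (i D v : ℕ) :
    (erase i D).testBit v = (D.testBit v && !i.testBit v) := by
  show (D ^^^ (D &&& i)).testBit v = _
  rw [Nat.testBit_xor, Nat.testBit_and]
  cases D.testBit v <;> cases i.testBit v <;> rfl

theorem land_lt_left {D n : ℕ} (m : ℕ) (hD : D < 2 ^ n) : D &&& m < 2 ^ n :=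
  Nat.and_le_left.trans_lt hD

theorem erase_lt {i D : ℕ} (hD : D < 2 ^ 315) : erase i D < 2 ^ 315 :=
  Nat.xor_lt_two_pow hD (land_lt_left i hD)

theorem testBit_shiftLeft_one (v w : ℕ) : (Nat.shiftLeft 1 v).testBit w = decide (v = w) := by
  show (1 <<< v).testBit w = _
  rw [Nat.shiftLeft_eq, one_mul, Nat.testBit_two_pow]

theorem exists_xor_and_sub_one_eq_two_pow {P : ℕ} (hP : P ≠ 0) :
    ∃ w, P.testBit w = true ∧ P ^^^ (P &&& (P - 1)) = 2 ^ w := by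
  induction P using Nat.strong_induction_on with
  | _ P ih =>
    obtain ⟨m, rfl | rfl⟩ := Nat.even_or_odd' P
    · obtain ⟨w, hw, h⟩ := ih m (by omega) (by omega)
      refine ⟨w + 1, by simpa [Nat.testBit_succ] using hw, ?_⟩
      refine Nat.eq_of_testBit_eq fun v => ?_
      rw [pow_succ', ← h]
      cases v with
      | zero => simp
      | succ v =>
        rw [Nat.testBit_succ, Nat.testBit_succ, Nat.xor_div_two, Nat.and_div_two]
        rw [show (2 * m - 1) / 2 = m - 1 by omega, Nat.mul_div_cancel_left _ two_pos,
          Nat.mul_div_cancel_left _ two_pos]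
    · refine ⟨0, by simp, ?_⟩
      refine Nat.eq_of_testBit_eq fun v => ?_
      cases v with
      | zero =>
        rw [Nat.testBit_xor, Nat.testBit_and, add_tsub_cancel_right]
        simp
      | succ v =>
        rw [Nat.testBit_succ, Nat.testBit_succ, Nat.xor_div_two, Nat.and_div_two]
        rw [show (2 * m + 1 - 1) / 2 = m by omega, show (2 * m + 1) / 2 = m by omega]
        simp

theorem two_pow_mod_injOn {v w : ℕ} (hv : v < 315) (hw : w < 315)
    (h : 2 ^ v % 317 = 2 ^ w % 317) : v = w := by
  have nd : ((List.range 315).map fun v => 2 ^ v % 317).Nodup := by decide +kernel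
  exact List.inj_on_of_nodup_map nd (List.mem_range.2 hv) (List.mem_range.2 hw) h

theorem eq_of_slot_add_eq {u v w z : ℕ} (hu : u < 315) (hv : v < 315) (hw : w < 315)
    (hz : z < 315) (h : slot u + v = 315 * (2 ^ w % 317) + z) : u = w ∧ v = z := by
  replace h : 315 * (2 ^ u % 317) + v = 315 * (2 ^ w % 317) + z := h
  exact ⟨two_pow_mod_injOn hu hw (by omega), by omega⟩

theorem adj_of_testBit_row {w u : ℕ} (hw : w < 315) (hu : u < 315)
    (h : (row (2 ^ w % 317)).testBit u = true) : Adj w u := by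
  replace h : ((adjBits >>> (315 * (2 ^ w % 317))) &&& allBits).testBit u = true := h
  rw [Nat.testBit_and, Nat.testBit_shiftRight, Bool.and_eq_true] at h
  replace h := h.1
  suffices H : ∀ l : List (ℕ × ℕ), (∀ e ∈ l, e.1 < 315 ∧ e.2 < 315) →
      (l.foldr (fun e r => Nat.lor r (Nat.lor (Nat.shiftLeft 1 (Nat.add (slot e.1) e.2))
        (Nat.shiftLeft 1 (Nat.add (slot e.2) e.1)))) 0).testBit
          (315 * (2 ^ w % 317) + u) = true → (w, u) ∈ l ∨ (u, w) ∈ l from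
    H edges lt_of_mem_edges h
  intro l
  induction l with
  | nil => simp
  | cons e l ih =>
    obtain ⟨p, q⟩ := e
    intro hl h
    obtain ⟨hp, hq⟩ := hl (p, q) List.mem_cons_self
    rw [List.foldr_cons] at h
    replace h := (Nat.testBit_or _ _ _).symm.trans h
    rw [Bool.or_eq_true] at h
    rcases h with h | h
    · rcases ih (fun e he => hl e (List.mem_cons_of_mem _ he)) h with h | h
      · exact .inl (List.mem_cons_of_mem _ h)
      · exact .inr (List.mem_cons_of_mem _ h)
    · replace h := (Nat.testBit_or _ _ _).symm.trans h
      rw [Bool.or_eq_true, testBit_shiftLeft_one, testBit_shiftLeft_one, decide_eq_true_eq,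
        decide_eq_true_eq] at h
      rcases h with h | h
      · obtain ⟨rfl, rfl⟩ := eq_of_slot_add_eq hp hq hw hu h
        exact .inl List.mem_cons_self
      · obtain ⟨rfl, rfl⟩ := eq_of_slot_add_eq hq hp hw hu h
        exact .inr List.mem_cons_self

theorem force_eq {α : Type} (n : ℕ) (k : ℕ → α) : force n k = k n := by cases n <;> rfl

theorem adj_of_testBit_neighbors {u : ℕ} (hu : u < 315) (fuel : ℕ) {P acc : ℕ}
    (hP : P < 2 ^ 315) (h : (neighbors fuel P acc).testBit u = true) :
    acc.testBit u = true ∨ ∃ w < 315, P.testBit w = true ∧ Adj w u := by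
  induction fuel generalizing P acc with
  | zero => exact .inl h
  | succ n ih =>
    by_cases h0 : P = 0
    · subst h0
      exact .inl h
    · obtain ⟨w, hw, hw'⟩ := exists_xor_and_sub_one_eq_two_pow h0
      have hw315 : w < 315 := by
        by_contra hc
        rw [Nat.testBit_lt_two_pow (hP.trans_le (Nat.pow_le_pow_right two_pos (not_lt.1 hc)))] at hw
        cases hw
      have e : neighbors (n + 1) P acc =
          neighbors n (P &&& (P - 1)) (acc ||| row (2 ^ w % 317)) := by
        have hb : Nat.beq P 0 = false := by
          cases hb : Nat.beq P 0
          · rfl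
          · exact absurd (Nat.eq_of_beq_eq_true hb) h0
        have e' : neighbors (n + 1) P acc = Bool.rec (force ((P ^^^ (P &&& (P - 1))) % 317)
          (fun s => neighbors n (P &&& (P - 1)) (acc ||| row s))) acc (Nat.beq P 0) := rfl
        rw [e', hb, force_eq, hw']
      rw [e] at h
      rcases ih (land_lt_left _ hP) h with h | ⟨v, hv, hvP, hvu⟩
      · rw [Nat.testBit_or, Bool.or_eq_true] at h
        rcases h with h | h
        · exact .inl h
        · exact .inr ⟨w, hw315, hw, adj_of_testBit_row hw315 hu h⟩
      · rw [Nat.testBit_and, Bool.and_eq_true] at hvP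
        exact .inr ⟨v, hv, hvP.1, hvu⟩

/-- The bit set `D` contains all vertices of colour `k`. -/
def Covers (col : ℕ → Fin 4) (k : Fin 4) (D : ℕ) : Prop :=
  D < 2 ^ 315 ∧ ∀ v < 315, col v = k → D.testBit v = true

namespace Covers

variable {col : ℕ → Fin 4} {k : Fin 4} {D : ℕ}

theorem erase (h : Covers col k D) {v : ℕ} (hv : col v ≠ k) :
    Covers col k (erase (Nat.shiftLeft 1 v) D) := by
  refine ⟨erase_lt h.1, fun w hw hwk => ?_⟩
  rw [testBit_erase, testBit_shiftLeft_one, h.2 w hw hwk]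
  have : v ≠ w := by
    rintro rfl
    exact hv hwk
  simp [this]

theorem update (hcol : ∀ e ∈ edges, col e.1 ≠ col e.2) (h : Covers col k D) {S : ℕ}
    (hS : ∀ v < 315, S.testBit v = true → D.testBit v = true → col v = k) :
    Covers col k (update D S) := by
  refine ⟨erase_lt h.1, fun u hu huk => ?_⟩
  refine (testBit_erase (neighbors 315 (S &&& D) 0) D u).trans ?_
  rw [h.2 u hu huk, Bool.true_and, Bool.not_eq_true', Bool.eq_false_iff]
  intro hn
  rcases adj_of_testBit_neighbors hu 315 (Nat.and_lt_two_pow S h.1) hn with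
    hn | ⟨v, hv, hvS, hvu⟩
  · simp at hn
  · rw [Nat.testBit_and, Bool.and_eq_true] at hvS
    have hvk := hS v hv hvS.1 hvS.2
    rcases hvu with hvu | hvu
    · exact hcol _ hvu (hvk.trans huk.symm)
    · exact hcol _ hvu (huk.trans hvk.symm)

theorem disjointOr_eq_false (h : Covers col k D) {v : ℕ} (hv : v < 315) (hvk : col v = k)
    {r : Bool} (hr : r = false) : disjointOr (Nat.shiftLeft 1 v) D r = false := by
  have h0 : Nat.beq (Nat.land D (Nat.shiftLeft 1 v)) 0 = false := by
    rw [Bool.eq_false_iff]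
    intro hb
    have h1 : (D &&& Nat.shiftLeft 1 v).testBit v = false := by
      rw [show D &&& Nat.shiftLeft 1 v = 0 from Nat.eq_of_beq_eq_true hb, Nat.zero_testBit]
    rw [Nat.testBit_and, h.2 v hv hvk, testBit_shiftLeft_one] at h1
    simp at h1
  rw [disjointOr, h0, hr]

end Covers

theorem refutes_x : refutes .x = propagate (fun _ _ _ _ _ => false) 100 := rfl

theorem refutes_b (v : ℕ) (t₀ t₁ t₂ t₃ : SearchTree) :
    refutes (.b v t₀ t₁ t₂ t₃) = propagate (fun a b c d e =>
      andThen (Nat.ble v 314)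
        (andThen (disjointOr (Nat.shiftLeft 1 v) a (refutes t₀ a (erase (Nat.shiftLeft 1 v) b)
          (erase (Nat.shiftLeft 1 v) c) (erase (Nat.shiftLeft 1 v) d) e))
        (andThen (disjointOr (Nat.shiftLeft 1 v) b (refutes t₁ (erase (Nat.shiftLeft 1 v) a) b
          (erase (Nat.shiftLeft 1 v) c) (erase (Nat.shiftLeft 1 v) d) e))
        (andThen (disjointOr (Nat.shiftLeft 1 v) c (refutes t₂ (erase (Nat.shiftLeft 1 v) a)
          (erase (Nat.shiftLeft 1 v) b) c (erase (Nat.shiftLeft 1 v) d) e))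
          (disjointOr (Nat.shiftLeft 1 v) d (refutes t₃ (erase (Nat.shiftLeft 1 v) a)
          (erase (Nat.shiftLeft 1 v) b) (erase (Nat.shiftLeft 1 v) c) d e)))))) 100 := rfl

theorem andThen_eq_and (a b : Bool) : andThen a b = (a && b) := by cases a <;> rfl

theorem propagate_succ (k : ℕ → ℕ → ℕ → ℕ → ℕ → Bool) (n a b c d e : ℕ) :
    propagate k (Nat.succ n) a b c d e =
      select (Nat.beq (Nat.lor (Nat.lor a b) (Nat.lor c d)) allBits) true
        (propagateStep (propagate k n) k a b c d e
          (Nat.xor allBits (Nat.lor e (Nat.lor (Nat.land (Nat.lor a b) (Nat.lor c d))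
            (Nat.lor (Nat.land a b) (Nat.land c d)))))) := rfl

theorem propagate_eq_false {col : ℕ → Fin 4} (hcol : ∀ e ∈ edges, col e.1 ≠ col e.2)
    {k : ℕ → ℕ → ℕ → ℕ → ℕ → Bool}
    (hk : ∀ a b c d e, Covers col 0 a → Covers col 1 b → Covers col 2 c → Covers col 3 d →
      k a b c d e = false) (fuel : ℕ) {a b c d : ℕ} (e : ℕ) (ha : Covers col 0 a)
    (hb : Covers col 1 b) (hc : Covers col 2 c) (hd : Covers col 3 d) :
    propagate k fuel a b c d e = false := by
  induction fuel generalizing a b c d e with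
  | zero => rfl
  | succ n ih =>
    have full : (a ||| b) ||| (c ||| d) = allBits := by
      refine eq_allBits (Nat.or_lt_two_pow (Nat.or_lt_two_pow ha.1 hb.1)
        (Nat.or_lt_two_pow hc.1 hd.1)) fun v hv => ?_
      have : col v = 0 ∨ col v = 1 ∨ col v = 2 ∨ col v = 3 := by
        generalize col v = x
        revert x
        decide
      rcases this with h | h | h | h
      · simp [ha.2 v hv h]
      · simp [hb.2 v hv h]
      · simp [hc.2 v hv h]
      · simp [hd.2 v hv h]
    replace full : Nat.lor (Nat.lor a b) (Nat.lor c d) = allBits := full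
    rw [propagate_succ, full, Nat.beq_refl]
    obtain ⟨S, hSdef⟩ : ∃ S, S = Nat.xor allBits (Nat.lor e (Nat.lor
        (Nat.land (Nat.lor a b) (Nat.lor c d)) (Nat.lor (Nat.land a b) (Nat.land c d)))) :=
      ⟨_, rfl⟩
    rw [← hSdef]
    show propagateStep (propagate k n) k a b c d e S = false
    rw [propagateStep]
    have hS : ∀ v < 315, S.testBit v = true →
        (a.testBit v = true → col v = 0) ∧ (b.testBit v = true → col v = 1) ∧
        (c.testBit v = true → col v = 2) ∧ (d.testBit v = true → col v = 3) := by
      intro v hv h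
      replace hSdef : S = allBits ^^^ (e ||| (((a ||| b) &&& (c ||| d)) |||
        ((a &&& b) ||| (c &&& d)))) := hSdef
      rw [hSdef, Nat.testBit_xor, testBit_allBits] at h
      simp only [Nat.testBit_or, Nat.testBit_and, hv, decide_true] at h
      have h0 := ha.2 v hv
      have h1 := hb.2 v hv
      have h2 := hc.2 v hv
      have h3 := hd.2 v hv
      revert h h0 h1 h2 h3
      generalize a.testBit v = a, b.testBit v = b, c.testBit v = c, d.testBit v = d,
        e.testBit v = e, col v = x
      revert a b c d e x
      decide
    cases Nat.beq S 0
    · exact ih _ (ha.update hcol fun v hv h => (hS v hv h).1)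
        (hb.update hcol fun v hv h => (hS v hv h).2.1)
        (hc.update hcol fun v hv h => (hS v hv h).2.2.1)
        (hd.update hcol fun v hv h => (hS v hv h).2.2.2)
    · exact hk a b c d e ha hb hc hd

theorem refutes_eq_false {col : ℕ → Fin 4} (hcol : ∀ e ∈ edges, col e.1 ≠ col e.2)
    (t : SearchTree) {a b c d : ℕ} (e : ℕ) (ha : Covers col 0 a) (hb : Covers col 1 b)
    (hc : Covers col 2 c) (hd : Covers col 3 d) :
    refutes t a b c d e = false := by
  induction t generalizing a b c d e with
  | x =>
    rw [refutes_x]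
    exact propagate_eq_false hcol (fun _ _ _ _ _ _ _ _ _ => rfl) 100 e ha hb hc hd
  | b v t₀ t₁ t₂ t₃ ih₀ ih₁ ih₂ ih₃ =>
    rw [refutes_b]
    refine propagate_eq_false hcol (fun a b c d e ha hb hc hd => ?_) 100 e ha hb hc hd
    by_cases hv : Nat.ble v 314 = true
    · replace hv : v < 315 := Nat.lt_succ_of_le (Nat.le_of_ble_eq_true hv)
      simp only [andThen_eq_and, Bool.and_eq_false_iff]
      have : col v = 0 ∨ col v = 1 ∨ col v = 2 ∨ col v = 3 := by
        generalize col v = x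
        revert x
        decide
      rcases this with h | h | h | h
      · exact .inr (.inl (ha.disjointOr_eq_false hv h (ih₀ e ha (hb.erase (by simp [h]))
          (hc.erase (by simp [h])) (hd.erase (by simp [h])))))
      · exact .inr (.inr (.inl (hb.disjointOr_eq_false hv h (ih₁ e (ha.erase (by simp [h])) hb
          (hc.erase (by simp [h])) (hd.erase (by simp [h]))))))
      · exact .inr (.inr (.inr (.inl (hc.disjointOr_eq_false hv h (ih₂ e (ha.erase (by simp [h]))
          (hb.erase (by simp [h])) hc (hd.erase (by simp [h])))))))
      · exact .inr (.inr (.inr (.inr (hd.disjointOr_eq_false hv h (ih₃ e (ha.erase (by simp [h]))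
          (hb.erase (by simp [h])) (hc.erase (by simp [h])) hd)))))
    · rw [Bool.not_eq_true] at hv
      simp only [hv]
      rfl

theorem covers_initial {col : ℕ → Fin 4} {l : List (ℕ × ℕ)}
    (hl : ∀ p ∈ l, (col p.1 : ℕ) = p.2) (k : Fin 4) : Covers col k (initial l k) := by
  induction l with
  | nil => exact ⟨allBits_lt, fun v hv _ => by simp [initial, testBit_allBits, hv]⟩
  | cons p l ih =>
    have ih := ih fun p hp => hl p (List.mem_cons_of_mem _ hp)
    have hp := hl p List.mem_cons_self
    show Covers col k (Bool.rec (erase (Nat.shiftLeft 1 p.1) (initial l k)) (initial l k)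
      (Nat.beq p.2 k))
    cases hb : Nat.beq p.2 k
    · refine ih.erase fun h => ?_
      rw [← hp, h, Nat.beq_refl] at hb
      cases hb
    · exact ih

theorem refutesFrom_eq_false {col : ℕ → Fin 4} (hcol : ∀ e ∈ edges, col e.1 ≠ col e.2)
    {l : List (ℕ × ℕ)} (hl : ∀ p ∈ l, (col p.1 : ℕ) = p.2) (t : SearchTree) :
    refutesFrom l t = false :=
  refutes_eq_false hcol t 0 (covers_initial hl 0) (covers_initial hl 1) (covers_initial hl 2)
    (covers_initial hl 3)

/-! ### The search -/

open SearchTree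

/-- A search for colourings in which vertex `221` has colour `0`. -/
noncomputable def searchTree₀ : SearchTree :=
  b 173 x x (b 224 x (b 180 (b 291 (b 222 x (b 170 x x x (b 250 x (b 122 x x x x) x x)) (b 225 x x x
  x) (b 71 x x x (b 122 x (b 81 x x x x) (b 284 x x (b 262 x (b 207 x x (b 98 (b 111 x x x (b 142 (b
  88 x x (b 275 x x x (b 45 x x x (b 81 x x (b 169 x (b 138 x x x x) x x) x))) x) x x x)) x x x) x)
  x x) x) (b 36 (b 293 x x (b 38 x (b 74 (b 294 x (b 308 x x (b 192 x x x (b 252 x x x (b 90 x x x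
  x))) x) x x) (b 223 x x x (b 287 x (b 61 (b 155 x x x (b 281 x (b 158 x x x x) x x)) x x x) x x))
  (b 164 x (b 107 x x x x) x x) x) x x) x) x x x)))) x x x) x x (b 222 (b 297 x x x (b 172 x (b 291
  x x x (b 261 x x x (b 38 x (b 268 x x (b 122 x x x (b 219 x (b 39 x (b 75 x (b 123 x x x (b 243 (b
  107 x x x x) x (b 158 x x x x) (b 205 (b 263 x (b 301 x x x x) x x) x x x))) x x) x (b 293 x x x
  x)) (b 228 (b 65 x (b 142 x x x (b 192 x x x x)) x x) x (b 302 x (b 243 x x (b 158 x x x x) x) x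
  x) x) x)) x) x (b 259 x x x x)))) (b 122 x x x (b 176 (b 81 (b 296 x (b 217 x x x (b 258 x (b 305
  x x (b 260 x (b 262 x x x (b 146 x (b 295 x x (b 159 x x x x) x) x x)) (b 281 x (b 78 x x x (b 80
  x x (b 90 x x x x) x)) x x) x) x) (b 107 x x x x) x)) x x) x x x) x x x)) (b 42 x x (b 240 x x x
  x) (b 39 x (b 243 (b 158 x x x x) x (b 100 x x (b 2 x x (b 192 x x x x) x) x) (b 312 (b 2 x x x (b
  205 (b 214 x (b 154 x x (b 215 x x (b 6 (b 90 x x x x) x x x) x) x) x x) x x (b 158 x x x x))) x x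
  x)) (b 251 x x x x) x)))) x x x)) x (b 297 x (b 222 (b 171 (b 261 x (b 112 (b 296 x (b 243 (b 98 x
  (b 249 x x (b 2 x x x x) (b 148 x x x x)) x x) x x (b 155 x x (b 100 x x x x) (b 31 x (b 98 (b 74
  (b 206 x (b 148 (b 232 x x (b 5 x (b 90 x x x x) x x) x) x x x) x x) x x x) x x x) x x))) (b 38 x
  (b 70 x x (b 127 (b 229 x x (b 158 x (b 107 (b 21 x x x x) x x x) x x) (b 90 x (b 195 x x x x) x
  x)) x (b 280 (b 153 (b 192 x (b 198 x x (b 212 x x (b 89 x x x x) x) (b 90 (b 89 x x x x) (b 244 x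
  x (b 96 x x x (b 89 x x x x)) x) x x)) x (b 212 (b 152 x x x x) (b 144 x x (b 59 x x x x) x) (b 31
  x (b 98 (b 29 x x x x) x x x) x x) x)) x x x) x (b 74 x x (b 265 (b 78 (b 229 x x (b 301 x x x (b
  203 x (b 107 (b 90 x x x x) x x x) x x)) (b 152 (b 155 x x x x) x x x)) x x (b 104 x (b 193 x x x
  (b 108 (b 250 (b 192 x x (b 166 (b 212 (b 58 x (b 155 x x x x) x x) x (b 105 x x x x) x) x (b 100
  x x x x) x) (b 155 x x (b 107 x x x x) (b 152 x (b 61 x x x x) x x))) x x x) x (b 250 x x x (b 212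
  (b 281 x x x (b 214 x x (b 254 x x (b 90 x x x x) x) x)) x x x)) x)) (b 161 x x x (b 189 x x x x))
  (b 192 x (b 105 (b 155 x x x (b 107 x x x x)) x (b 158 x x x x) (b 34 (b 138 x x x x) x x x)) (b
  212 (b 56 x x (b 6 x x x x) x) x x x) x))) x x x) x) x) x) x) x x) (b 181 x x x (b 258 x x x (b
  226 x (b 122 x (b 84 x x (b 213 x (b 280 x x x (b 97 (b 262 x (b 101 x x (b 259 x (b 242 x x x x)
  (b 290 x x (b 293 x x x (b 71 x x (b 89 (b 77 x x x x) x x (b 229 x x x x)) x)) x) (b 158 x x x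
  x)) x) x x) x x x)) x x) x) (b 304 x x x (b 36 (b 115 x (b 100 x x x x) x (b 206 x x (b 255 x (b
  107 x x x x) x x) (b 250 x x (b 190 (b 156 x x x (b 97 (b 298 x x (b 110 x x x (b 153 x x (b 152 x
  x x x) (b 301 x x (b 192 x (b 291 x (b 152 x x x x) (b 203 (b 205 x x x x) (b 105 x x x x) x x) x)
  x (b 100 x x x (b 203 x (b 214 x x x (b 90 x x x x)) x x))) (b 259 x x (b 214 (b 195 x x x x) (b
  100 x x x (b 31 x x x x)) x x) x)))) x) x x x)) x x x) x))) x x x)) x) x x)))) x x x) (b 291 x x x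
  x) (b 291 x x x (b 259 x x x (b 123 x x x (b 122 x (b 249 x x x x) x (b 82 (b 253 x (b 213 x x x
  x) x x) x (b 265 (b 228 (b 284 (b 306 x x (b 210 x x (b 29 x x (b 58 x (b 249 (b 281 x (b 105 x x
  x (b 127 x x (b 262 (b 2 x x x (b 35 (b 63 (b 308 x (b 154 (b 168 x x x x) (b 159 x x x (b 226 x
  (b 108 (b 151 x x (b 138 (b 93 x x (b 195 x x x (b 90 x x x x)) x) x x x) x) x x x) x x)) (b 78 x
  x x x) x) x x) x x x) (b 108 x x x x) x x)) x x x) x)) x x) x x x) x x) x) x) x) x x x) x (b 306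
  (b 155 x x (b 158 (b 249 x x x (b 211 x (b 89 x x x x) x x)) (b 98 x (b 152 x x (b 210 x x x (b 78
  (b 290 x x x (b 150 x (b 30 x (b 6 x x x x) x x) x x)) x x x)) x) x x) x x) (b 284 x x x x)) x x
  x) (b 105 x x x (b 226 x (b 212 x x (b 214 x (b 63 (b 251 x x (b 89 x x (b 152 x x x x) x) x) x x
  x) x x) x) x x))) (b 211 x x x (b 202 x x (b 289 x x x (b 97 (b 208 x x (b 149 (b 147 (b 159 x (b
  189 x (b 100 x x x x) x x) x (b 90 x x x x)) x x x) x x x) x) x x (b 107 x (b 205 (b 144 x x (b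
  160 x (b 45 x (b 35 x x x x) x x) x x) x) x x x) x x))) x)) x x) x)))))) x x (b 70 x x (b 19 x (b
  61 x (b 166 (b 158 x x x x) x x x) x x) (b 249 (b 284 (b 98 x x x x) x x x) x x x) (b 24 x x x x))
  x)) (b 82 (b 181 x x x (b 291 (b 148 (b 107 x x (b 239 x (b 96 x x (b 61 (b 150 x x x (b 212 x x x
  (b 248 (b 29 x x x (b 282 (b 192 x x x x) x (b 204 x x x x) (b 31 x x x (b 189 x x x (b 191 x x (b
  192 x x x x) x))))) x x x))) x x x) x) x x) x) x x x) x x x)) x (b 226 (b 266 x (b 258 x x x (b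
  175 (b 122 x x x (b 127 x (b 105 x x (b 212 x (b 205 x x (b 158 x (b 61 x x (b 34 (b 6 x x x x) x
  x x) x) x x) x) x x) x) x x)) x x x)) x x) x x x) x) (b 172 x x (b 217 x (b 260 x (b 291 (b 180 (b
  223 x x x x) x x (b 293 x x (b 125 x x (b 67 x (b 177 x (b 70 x x (b 223 x x x x) (b 176 (b 183 x
  (b 114 x x (b 100 x (b 107 x x (b 251 x x (b 212 x x x (b 262 (b 153 x x x x) x x x)) x) x) x (b
  251 x x x x)) x) x x) x x x)) x x) x x) x) (b 74 (b 145 x x (b 66 x (b 98 x (b 105 (b 192 x x x x)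
  x x x) x x) x x) x) x x x))) (b 125 x x (b 122 x (b 82 x x (b 252 x x x x) x) x (b 82 x x (b 262
  (b 223 x x x (b 105 x (b 299 (b 39 x x x x) x x x) x x)) x x x) x)) x) x x) x (b 98 x (b 100 x x
  (b 205 x x x x) x) x x)) x x) x) x) (b 268 x x x (b 262 (b 175 (b 172 x x (b 218 x x x (b 226 (b
  296 x x x (b 238 x (b 258 x x x (b 183 (b 177 x (b 41 (b 291 x x (b 212 x x (b 100 x x x (b 61 x x
  (b 274 x (b 192 x x x x) x x) x)) x) x) x x (b 191 x x (b 212 x x x x) x)) x x) x x x)) x x)) x x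
  x)) x) x x x) (b 116 x x x (b 38 x x x x)) x x)) x)) (b 224 x (b 304 x (b 293 x (b 260 x x x (b
  219 (b 225 x x x (b 181 (b 67 (b 111 (b 108 x x x (b 250 x (b 295 (b 127 (b 103 x x x (b 29 x x x
  (b 214 x x x (b 252 x x x (b 153 x x x x))))) x x x) x x x) x x)) x x x) x x (b 148 x (b 204 x x
  (b 60 x x x (b 108 x x x (b 127 (b 193 (b 147 x (b 151 (b 191 (b 313 x x (b 282 x x x (b 252 x x x
  (b 153 x x x x))) x) x x x) x x x) x x) x x x) x x x))) x) x x)) x x x)) x x x)) (b 175 x x x (b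
  270 x x x (b 115 x (b 39 x x x x) x x))) x) (b 222 (b 262 (b 177 (b 297 x x (b 259 x (b 116 x x x
  x) (b 293 x x x (b 125 (b 172 x (b 223 x x (b 175 x x x (b 39 x (b 74 x x x (b 41 (b 98 (b 291 x x
  x x) (b 107 (b 212 (b 38 x x (b 152 x x x x) x) x x x) x (b 249 x x (b 300 x x x (b 247 x (b 56 x
  (b 162 x x (b 231 x x x x) x) x x) x x)) x) x) x x) x x x)) (b 294 x x x x) x)) x) (b 39 x (b 287
  x (b 223 x x (b 243 (b 158 x x x x) x (b 312 (b 2 x x (b 251 (b 152 x x x x) x x (b 162 x (b 89 x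
  x x x) x x)) x) x x x) (b 254 x (b 158 x x x x) x x)) (b 230 x x x x)) x x) x x) x) x x x)) x) (b
  252 x x (b 194 x x (b 267 x x x x) x) x)) x x x) x x x) (b 293 x x (b 265 x x x (b 171 x (b 116 (b
  106 x (b 209 x x (b 290 x x x (b 246 x x (b 248 x x (b 90 x x x x) x) x)) x) x x) x x (b 219 (b
  122 x (b 108 x (b 213 (b 153 x (b 151 x x x (b 291 (b 39 x x (b 258 x x (b 215 x x (b 99 x x (b 76
  (b 155 x x x x) (b 105 (b 31 (b 89 x x x x) x x x) x x x) (b 223 x x (b 105 x x x x) (b 229 x (b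
  107 x (b 38 x x (b 98 x x x x) (b 21 (b 105 (b 158 x x x x) x x x) x (b 96 x x (b 162 x x x (b 212
  x x x x)) x) x)) x (b 90 x x x x)) (b 205 x x (b 155 x (b 158 x x x x) x x) x) x)) x) x) x) x) x)
  x x x)) x x) x x x) x x) x (b 295 (b 100 x (b 98 x x x x) x x) x x x)) x (b 290 x (b 215 x x (b
  151 x x x (b 155 x (b 21 (b 5 x x x x) x (b 251 x (b 100 x (b 274 x x x x) x x) x (b 105 x x x (b
  29 x x x (b 73 (b 192 x x x x) x x x)))) x) x (b 21 (b 29 (b 152 x (b 88 x (b 195 x x x x) x x) x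
  x) x (b 61 x x x x) x) x (b 1 x (b 105 x x x x) x (b 73 x x (b 205 (b 152 x x x x) x x x) x)) x)))
  x) x x) x)) x x)) x) (b 172 x (b 225 x x x (b 116 (b 262 x (b 252 (b 90 x x x x) x x x) x x) x x
  (b 174 (b 251 x x x x) x x (b 79 x x (b 308 x (b 107 x x x x) x x) (b 71 (b 166 x x x x) x (b 70
  (b 223 x x (b 183 (b 110 x x (b 122 x (b 159 x x x (b 294 x x x x)) x x) x) x x x) (b 176 x (b 145
  (b 252 (b 108 x x x (b 100 x x x x)) x x x) x x x) x x)) x x (b 258 x x (b 153 x x x x) x)) x)))))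
  x x) (b 116 x (b 265 x x x (b 219 (b 153 x x x x) x (b 79 x x (b 39 x x (b 258 x x (b 293 x x (b
  294 (b 205 x x x x) (b 82 (b 152 x (b 225 x x x x) x x) (b 125 (b 74 (b 290 x x x (b 159 (b 99 x
  (b 189 x x (b 89 x x x x) (b 51 x x (b 152 x x x x) x)) x x) x x (b 21 (b 19 (b 89 x x x (b 192 x
  x x x)) x x x) x x (b 90 x x x x)))) (b 179 x x (b 95 x x (b 96 x (b 100 x x x x) x x) x) (b 180
  (b 71 (b 287 x (b 75 (b 107 (b 150 (b 212 x x x x) x x x) (b 153 x (b 290 x x x (b 96 (b 189 x x x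
  x) x (b 255 x x (b 21 x x (b 99 x x x x) x) x) x)) x x) x (b 249 x x (b 218 x x x x) x)) x (b 212
  x x (b 155 x x x x) x) x) x x) x x (b 218 x (b 107 (b 251 x x x x) (b 152 x (b 90 x x x x) x x) x
  (b 249 x x x x)) (b 99 (b 204 x (b 252 x x x (b 250 x x x (b 120 x x (b 138 x x x x) x))) x x) x
  (b 212 x x (b 155 x x x x) x) (b 259 x x x (b 96 x (b 34 x x x x) (b 34 x x x x) (b 155 x x x
  x)))) x)) x (b 259 x x x (b 153 x (b 110 x x x (b 109 x (b 212 x x x x) (b 284 x x x x) (b 205 x x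
  x x))) (b 111 x x x (b 62 x (b 108 x x (b 100 x x (b 152 x x (b 212 (b 205 x x x x) x x x) x) x)
  (b 212 x x x x)) x x)) x)) x)) x x) x x x) x x) x x) (b 192 x x x x)) x) x) x) x)) x x)) x) x (b
  180 (b 260 x (b 190 x x (b 106 x (b 125 (b 209 x x (b 285 x (b 99 (b 120 x x (b 138 x x x x) x) x
  (b 160 x x x x) x) x x) x) x x x) x x) x) (b 176 (b 159 (b 147 x (b 275 x x x x) (b 155 x (b 103 x
  x (b 192 x x x x) (b 288 x x x (b 59 x (b 146 x x x x) x x))) x (b 157 x x (b 34 (b 203 (b 251 x x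
  x (b 230 x x x x)) x x x) x x x) x)) x) x x x) x x x) (b 222 x (b 122 x (b 226 (b 290 x x x x) x
  (b 39 x x (b 262 x (b 78 x (b 225 x x (b 103 x (b 109 x x (b 254 x x (b 61 (b 207 x x (b 252 x x x
  (b 96 x x (b 151 x x x (b 158 (b 215 x x (b 161 x x (b 101 x x (b 283 (b 192 x x x x) x x (b 186 x
  x x x)) x) x) x) x x x)) x)) x) x x x) x) x) x x) (b 99 x x (b 108 x (b 290 x (b 215 x x (b 95 x
  (b 155 x (b 190 x x (b 294 (b 275 x x x (b 90 x x x x)) x x (b 21 (b 5 x x x x) x (b 251 (b 192 x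
  x x x) (b 214 x x x (b 249 x (b 89 x x x x) x x)) x (b 105 x x x (b 29 x x x (b 24 x (b 73 x x x
  x) x x)))) x)) x) x (b 38 x x (b 98 x x x x) (b 21 (b 29 (b 152 x (b 192 x x x (b 195 x x x x)) x
  x) x (b 61 x x x x) x) x (b 61 (b 251 x x x x) x (b 294 x x x (b 159 x x x (b 275 x x (b 160 (b
  152 x x x x) x x x) x))) x) x))) x x) x) x x) x x) x)) x x) x x) x) x) x x) x x)) x (b 268 x (b
  122 x x x (b 223 x x (b 250 (b 287 x (b 212 (b 99 x (b 74 (b 294 x x (b 286 x x (b 155 x x x x) x)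
  x) x x x) x x) x x x) x x) x x x) x)) (b 222 (b 287 x (b 70 (b 251 (b 158 x x x x) x x x) x (b 122
  x (b 293 x x (b 145 x x x (b 252 (b 267 x (b 158 x x x x) x (b 95 x x (b 250 x (b 158 x x x x) (b
  159 x (b 294 x x (b 249 (b 34 x x x x) x (b 205 x x x x) x) x) x x) (b 89 (b 62 x x (b 203 x x x
  x) x) x (b 203 x x x (b 240 x x x x)) x)) x)) x x x)) x) (b 290 x x x x) (b 291 x x (b 223 x x x
  x) (b 116 x (b 167 x x (b 250 (b 260 x (b 152 x x x x) (b 252 x (b 152 x x x x) (b 280 (b 90 (b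
  114 x x (b 165 x x (b 195 x x x x) x) x) x x (b 97 (b 152 x x x x) x x x)) x x x) (b 143 (b 193 x
  (b 275 x (b 102 x x x (b 158 x x x x)) x x) x x) x x x)) x) x x x) x) (b 127 (b 97 (b 298 x x x (b
  62 x (b 110 x x (b 301 x (b 138 x x x x) (b 206 x x (b 214 (b 195 x x x x) (b 212 x x x x) x x) x)
  (b 158 x (b 31 (b 27 x x x x) x x x) x x)) x) x x)) x x x) (b 205 x (b 96 x x x x) x x) (b 115 x x
  (b 204 (b 283 (b 238 x x (b 156 x x (b 223 x x x (b 252 (b 161 x x x (b 301 x (b 63 x (b 103 x x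
  (b 146 (b 58 x (b 89 x x x x) x x) x x x) x) x x) (b 179 x x (b 102 x x (b 100 x x x x) (b 152 x
  (b 74 (b 100 x x x x) x x x) x x)) x) (b 179 x x (b 192 x (b 288 x (b 57 x x x x) x (b 203 (b 205
  x x x x) (b 105 (b 195 x x x x) x x x) x (b 158 x x x x))) (b 29 (b 203 x (b 214 x x (b 59 x x x
  (b 160 x x x (b 27 x x x x))) x) x x) x x x) x) (b 96 x x x x)))) x x x)) x) x) x x x) (b 234 x x
  x (b 108 (b 202 x x (b 250 (b 280 (b 301 x (b 223 x x x (b 98 (b 212 x x x x) (b 166 x x x x) x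
  x)) (b 179 x x (b 226 x (b 214 (b 100 (b 192 x x x x) x x x) (b 31 x (b 35 (b 109 x (b 203 x x x
  (b 61 x x (b 59 x (b 17 x x x x) x x) x)) (b 98 (b 148 x x x x) x x x) x) x x x) x x) (b 152 x x x
  x) x) (b 98 (b 158 x x x (b 5 x x (b 192 x x x x) x)) x x x) x) (b 61 x x x x)) (b 179 x x (b 203
  (b 189 x x x x) (b 226 x (b 158 (b 89 x x x x) (b 105 (b 107 x x x x) x x x) x x) x x) x (b 100 x
  x x x)) x)) x x x) x x x) x) x x x)) x x) (b 203 x x x x)) x) x))) x) x x) (b 287 x (b 71 x x (b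
  226 (b 78 (b 156 x x (b 190 x (b 250 x x x (b 231 x x x x)) x x) x) x x x) x x x) x) x x) x (b 291
  (b 172 x (b 306 (b 96 x x x x) x x x) (b 223 x x x (b 167 (b 101 (b 290 x x x (b 294 x (b 228 (b
  79 x x (b 192 x (b 90 x x (b 103 x x x (b 214 x x x x)) x) x x) x) (b 11 x x (b 23 x x x x) x) x
  x) x x)) x x x) x (b 250 x x x (b 169 x (b 288 x x x (b 203 (b 244 x (b 131 x x x x) x x) (b 232
  (b 100 x x x x) x x x) x x)) x x)) x)) (b 122 x (b 42 (b 205 x x x x) x x x) (b 263 x x (b 298 x x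
  (b 95 x x (b 238 x x (b 296 x (b 206 x x (b 158 (b 155 x x x x) x x x) (b 211 x (b 124 (b 294 x x
  x x) x x (b 39 (b 152 x (b 155 x x x x) x x) (b 231 x x x (b 158 x x x x)) (b 286 x (b 34 (b 192 x
  (b 90 x x (b 191 x x (b 214 x x x x) x) x) x x) (b 241 x (b 205 x x x x) x x) x x) x x) x)) x x))
  x x) x) x) x) x) (b 38 x (b 74 (b 67 x x (b 232 x x x x) (b 97 (b 116 x (b 90 x x x (b 232 x x x
  x)) (b 204 (b 106 x (b 283 (b 96 x (b 155 x (b 158 x (b 205 x x x x) x x) x x) (b 205 x x x (b 158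
  x x x x)) x) x x x) x x) x x x) x) x x x)) x x x) x x))) x (b 172 x x (b 243 x x (b 155 x x x x)
  x) x) x)) (b 296 x x (b 172 x x x (b 74 (b 269 x x x (b 305 x x x (b 38 x (b 76 (b 193 (b 156 x x
  x (b 250 (b 101 x x x (b 41 (b 206 x (b 158 x x x x) x (b 105 x x x x)) x x x)) x x x)) x x x) x x
  x) (b 100 x x x x) x))) x x x)) (b 269 x x (b 38 x (b 313 x (b 70 x x x (b 67 (b 241 x x x x) x (b
  127 (b 229 x x (b 90 x (b 195 x x x x) x x) (b 158 x (b 251 x x x (b 155 x x x x)) x x)) x x (b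
  159 (b 99 (b 275 (b 90 x (b 185 x x x x) x x) x (b 24 x x x (b 107 x x x x)) x) x x x) (b 265 (b
  74 x x x (b 78 (b 204 (b 229 (b 192 x x x x) x (b 195 x x (b 100 x x x x) x) (b 208 x (b 301 x x
  (b 203 x (b 107 (b 90 x x x x) x x x) x x) x) x x)) x x x) x (b 262 (b 156 x (b 100 x x x x) (b
  106 x x x x) (b 250 x x (b 215 (b 90 x x x x) x (b 192 x (b 280 x (b 105 x x (b 158 x x x x) x) x
  (b 105 (b 98 x (b 212 x x x x) x x) x (b 98 x x x x) (b 158 x x x x))) x (b 34 x (b 214 x x x (b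
  155 x x x (b 281 x x (b 107 (b 59 x x x x) x x x) x))) x x)) x) x)) (b 192 x (b 105 (b 98 x (b 212
  x x x x) x x) x (b 98 x x x x) (b 158 x x x x)) x (b 246 x x x x)) x x) x)) x x x) (b 156 x x x x)
  x)) x)) x x) x x) x))) x))

set_option maxHeartbeats 0 in
theorem refutesFrom_searchTree₀ :
    refutesFrom [(221, 0), (292, 0), (22, 0), (119, 1), (220, 2)]
      searchTree₀ = true := by
  decide +kernel

/-- A search for colourings in which vertex `221` has colour `1`. -/
noncomputable def searchTree₁ : SearchTree :=
  b 259 x x (b 224 (b 70 (b 81 x x (b 222 x (b 175 x x x (b 267 x x x (b 125 (b 172 (b 41 x (b 226 x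
  x (b 300 x x x (b 158 x (b 212 (b 59 x x x x) x x x) x x)) (b 249 x x (b 300 x x x (b 306 (b 158 x
  (b 295 x (b 39 (b 105 x (b 61 x x x (b 160 x x (b 192 x (b 122 x x (b 152 x x (b 106 x (b 155 x x
  (b 90 x x x x) x) x x) x) x) x x) x)) x x) x x x) x x) x x) x x x)) x)) x x) x x x) x x x))) x (b
  172 (b 116 x (b 304 x x (b 205 x x x x) x) x x) x x x)) x) x x (b 116 (b 291 x x x x) (b 67 x x (b
  219 x x (b 102 x x x (b 284 x (b 251 x x x (b 105 (b 61 x x (b 89 x x x x) x) x x x)) x x)) x) (b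
  174 x x (b 267 x x x (b 71 (b 263 (b 155 x x x x) x x x) x (b 212 x x x x) (b 222 (b 289 x (b 201
  (b 79 x x x x) x x x) x x) x x (b 114 x x (b 152 x (b 98 x (b 293 x x (b 203 x x (b 284 x (b 262
  (b 59 x x (b 162 (b 251 x x x (b 35 x x x (b 109 x x (b 84 x x (b 204 (b 153 x x x (b 192 x (b 232
  x x (b 158 (b 195 x x x x) x x x) x) x x)) x x x) x) x))) x x x) x) x x x) x x) x) x) x x) x x) (b
  223 x x x (b 293 (b 158 x x x x) x x (b 231 (b 210 x x x (b 100 x (b 244 x (b 160 (b 12 x x (b 153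
  x (b 83 (b 211 x x x x) x x x) x (b 139 (b 52 x (b 161 x x (b 89 x x x x) x) x x) x x x)) x) x x
  x) x x) x x)) (b 155 x (b 107 x x x (b 152 x x (b 57 x x (b 306 (b 301 (b 181 (b 302 x (b 8 (b 64
  x x (b 241 x x x (b 90 x x (b 89 x x x x) x)) x) x x x) (b 192 x x x x) x) x x x) x x x) x x x) x)
  x)) x x) x x))))))) x)) x (b 222 x (b 38 (b 181 (b 293 (b 113 (b 152 x (b 29 x x x (b 282 x x (b
  290 x x x x) x)) (b 218 x x x x) x) x x x) x x (b 218 (b 313 (b 296 x (b 115 x x (b 251 x x x x)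
  (b 71 (b 194 x x x x) x (b 160 x x (b 312 x x (b 251 x (b 98 (b 270 (b 105 x (b 309 x (b 279 x (b
  172 x x (b 74 x (b 265 x (b 100 x x (b 90 x x x x) (b 106 (b 64 x x x (b 146 x (b 23 x x x x) x
  x)) x x x)) x x) x x) x) x x) x x) x x) x x x) x x x) x x) x) x) (b 228 x x x (b 231 x (b 155 x x
  x (b 251 x x x x)) x x)))) x x) x x x) x x (b 100 x x x x))) x x x) x x x) x x))) x x (b 126 (b 38
  (b 79 x x (b 222 (b 74 (b 261 x (b 112 (b 269 x x (b 116 x x (b 204 (b 95 x x (b 298 (b 231 x x (b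
  158 x (b 61 x x (b 212 x x x (b 249 x x x x)) x) x x) x) x x x) x) x x x) x) x) x x x) x x) x x x)
  (b 175 (b 226 (b 172 x x x (b 122 x x (b 294 x x x (b 89 (b 90 x x x x) x x x)) (b 225 (b 193 x (b
  116 (b 294 x x (b 61 (b 293 x x x x) x x x) x) x (b 115 x x (b 151 x x (b 280 x (b 124 x x x (b
  104 x x (b 159 (b 294 x x (b 89 x x x x) x) x (b 294 x x (b 204 (b 264 x x x (b 212 x x x x)) x x
  x) x) x) x)) x x) x) x) x) x x) x (b 294 x x x (b 39 x x x x)) x))) x x x) x x (b 123 x x (b 313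
  (b 289 x x (b 152 (b 5 x x x x) (b 6 x x x x) x x) x) x x x) x)) (b 172 x x x (b 268 x x x (b 218
  x x x (b 82 x (b 219 (b 213 x (b 231 x x (b 212 x x x x) x) x x) x x (b 106 x (b 78 x x (b 145 x x
  x (b 231 x (b 284 (b 66 x x x (b 155 x (b 306 (b 205 x x x (b 191 x x x x)) x x x) x x)) x x x) (b
  251 x x x x) x)) x) x x)) x (b 212 x x x x))))) x) (b 116 x x x (b 174 x x (b 258 (b 40 x x (b 106
  (b 250 x (b 78 x x (b 166 (b 281 x x x x) x x (b 107 x x x x)) x) (b 107 (b 251 x (b 155 x x x x)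
  (b 156 x x x (b 201 x x (b 159 x (b 275 x x x x) x x) x)) (b 158 x x (b 214 x x x x) x)) (b 249 x
  x (b 29 (b 255 x x x (b 215 x x (b 213 x x (b 160 x x (b 5 x x x x) x) x) x)) x x x) x) x x) x) (b
  293 (b 100 x x x x) x x (b 107 (b 251 x (b 155 x x x x) (b 142 (b 205 x x x x) x x x) (b 164 (b
  142 (b 58 (b 100 x (b 202 x x x (b 146 x x x (b 166 x x x (b 6 x x x (b 274 (b 90 x x x x) x x
  x))))) x x) x x x) x x x) x x x)) (b 249 x x (b 13 x x (b 61 (b 100 x x x (b 195 x x x x)) x x x)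
  x) x) x x)) x x) (b 100 x (b 155 x x (b 152 x x x x) x) x x)) x x (b 269 (b 106 (b 32 x x (b 204
  (b 242 x (b 33 (b 275 x (b 46 x x x x) (b 152 x x x x) x) x x x) x x) x x x) x) (b 147 x x x (b
  211 x x (b 89 x x (b 192 x x (b 90 x (b 105 x x x x) x x) x) x) x)) x (b 250 x x x x)) x (b 294 (b
  153 x x x x) x x (b 250 x (b 99 (b 145 x x x x) x x x) (b 242 x (b 213 x x (b 90 (b 189 x (b 138
  (b 279 x x x x) x x (b 140 x (b 107 x x x x) x x)) x (b 100 x x (b 212 (b 284 x x x x) x x x) x))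
  x x (b 223 x x (b 284 (b 152 (b 203 x x x x) x x (b 275 x x x x)) (b 158 x (b 89 x x x x) x x) x
  x) (b 21 x x x x))) x) x x) x)) x)) x))) x (b 222 x (b 269 x x x (b 111 x x x (b 159 x (b 161 x x
  x (b 40 x x (b 151 x x x x) x)) x x))) x x) (b 113 (b 174 x x (b 180 x x (b 41 x (b 116 x (b 102 x
  (b 61 x x x (b 80 x x x (b 94 x x x x))) x x) x (b 191 x x x x)) x x) (b 107 x x x x)) x) x x (b
  287 x (b 173 (b 258 x x (b 262 x (b 79 x x (b 181 x x x (b 158 x (b 105 x (b 180 x x x (b 76 x x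
  (b 124 x x x (b 243 (b 265 (b 248 x x (b 98 x x x (b 168 (b 42 (b 251 x x x x) x (b 186 x x x (b
  90 x x x x)) x) x x x)) (b 249 x x x x)) x x x) x x x)) x)) x x) x x)) x) x x) x) x (b 293 (b 103
  x x (b 90 x x x x) x) x x x) x) x x))) x (b 180 x x x (b 122 (b 258 x x (b 71 x x (b 261 x (b 226
  x (b 36 (b 76 x (b 306 x x x (b 158 x (b 289 x (b 105 x x (b 98 (b 155 x x (b 211 (b 253 (b 280 x
  (b 204 x x (b 231 (b 153 x x (b 270 x (b 193 (b 310 (b 106 (b 192 x x (b 90 x x x x) x) x x x) x x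
  x) x x x) x x) x) x x x) x) x x) x x x) x x x) x) x x x) x) x x) x x)) x x) x x x) x x) x x) x) x)
  x x (b 39 x x x x))) x)) (b 224 (b 70 (b 112 x x x (b 225 x x x (b 113 x x (b 269 x (b 219 x (b
  174 x x x (b 213 (b 152 x x x x) (b 159 x (b 124 x (b 169 x x x (b 97 x x (b 115 x x x (b 286 x (b
  252 x x x (b 289 (b 39 x (b 251 (b 301 x x x x) x x x) x x) x (b 294 x x x x) x)) x x)) x)) x x) x
  x) x (b 106 (b 206 (b 60 x x x (b 124 x (b 147 x x x (b 298 x (b 314 x x x (b 194 (b 102 x x (b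
  231 x x x (b 61 x (b 107 (b 90 x x x x) x x x) x x)) x) x x x)) x x)) x x)) x x x) x x x))) x x) x
  x) x))) x (b 122 (b 173 x x x (b 222 x x x x)) x (b 222 (b 177 x x x (b 291 x (b 97 x x (b 39 x (b
  59 (b 89 x x x x) x x x) x x) x) x (b 169 x x x (b 311 (b 182 (b 99 x x x x) (b 116 x (b 97 x (b
  125 x x x (b 269 x x x (b 215 x x (b 75 x (b 59 x x x x) x (b 106 x x x (b 155 x (b 250 x x (b 39
  x x (b 101 x x x (b 290 (b 299 x x (b 214 x x x x) x) x (b 202 x x x (b 88 x x (b 210 x x x x) (b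
  23 (b 6 x (b 192 x x x x) x x) x x (b 195 x (b 138 x x x (b 209 (b 274 x x (b 214 (b 275 x x x x)
  x x x) x) x x x)) x x)))) x)) x) x) (b 101 x x (b 214 x x x x) (b 39 x x (b 199 (b 2 x x x (b 11
  (b 61 x (b 279 x x x x) (b 131 x x x (b 90 x x x x)) x) x x x)) x x (b 61 x x (b 249 (b 34 x x x
  (b 90 x x x x)) x x x) x)) (b 107 x x x x))) x))) x))) x x) (b 183 x x (b 106 (b 105 x x x x) x x
  x) x) x) x x) x x x)))) (b 113 (b 298 x x (b 251 x x (b 308 x x (b 205 x x x x) x) x) x) x x x) (b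
  125 x x (b 82 (b 182 x (b 287 x x (b 78 (b 100 x x x x) x x (b 116 (b 66 x (b 223 x x x (b 169 x x
  x (b 110 (b 161 x x (b 39 x (b 152 (b 158 x x x x) x x x) x (b 60 x x x (b 296 x x x (b 152 x x x
  x)))) x) x x x))) x x) x x x)) x) x x) x x x) x) (b 116 x (b 261 (b 125 (b 223 x x x (b 226 x (b
  231 x (b 251 x x x x) x (b 61 x x x x)) (b 258 x x (b 173 x x (b 34 x (b 249 x x x x) x x) (b 290
  x x (b 82 x (b 113 (b 243 (b 34 x (b 169 x (b 90 x x x x) x x) x x) x x x) x x (b 239 (b 203 x (b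
  59 x x x (b 306 (b 123 (b 225 (b 34 x (b 31 x x (b 63 x x (b 279 x (b 192 x x x x) x x) x) (b 284
  x x (b 107 x x x (b 96 (b 151 (b 241 x x x x) (b 159 (b 106 x (b 99 (b 110 x x x (b 229 x x (b 152
  x x x x) x)) x x x) x x) x x x) x x) x x x)) x)) (b 90 x x x x) x) x (b 230 x x x x) x) x x x) x x
  x)) x x) (b 107 (b 98 x (b 207 x x x (b 255 x x (b 100 x (b 89 x x x x) x (b 34 (b 152 x (b 288 x
  x (b 205 (b 151 (b 131 (b 153 x x x (b 93 x x x x)) x x x) (b 147 x (b 6 x (b 166 x (b 213 (b 101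
  x x (b 153 x (b 250 x x x (b 294 x (b 131 (b 186 x (b 89 x x x x) x x) x (b 192 x x x x) x) x x))
  x x) x) x x x) x x) x x) x x) x x) x x (b 189 x (b 229 x x x x) x x)) x) x x) x x x)) x)) x x) (b
  152 x x x x) x x) x x)) x x) (b 155 x (b 204 x x x x) x x))) (b 294 x (b 156 x x (b 252 x x x (b
  161 (b 231 x (b 210 (b 164 x x (b 246 (b 274 (b 195 x x x x) x x x) x x x) x) x x x) x (b 251 x x
  x (b 61 x x (b 96 x x (b 249 x x x (b 166 x (b 186 x (b 89 x x x x) x x) x x)) x) x))) x x x)) x)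
  x x)) x)) x x x) x x x) x x)) (b 267 x x (b 265 x (b 173 (b 39 x x x x) x (b 260 x x x (b 114 x x
  (b 296 x (b 217 (b 231 x x x x) x x (b 71 (b 155 x x x x) x (b 226 x x (b 152 x x x x) (b 219 (b
  239 x (b 261 x x x (b 194 x (b 312 (b 59 x x x (b 299 (b 107 (b 308 x x (b 142 x x x (b 109 x x x
  (b 162 (b 63 (b 123 (b 201 (b 305 x x (b 252 x (b 115 x x (b 72 x (b 294 x x (b 146 (b 155 x x x
  x) x x x) (b 116 x x x x)) x x) x) (b 148 x x x x) x) x) x x x) x x x) x x x) x x x))) x) x x x) x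
  x x)) x x x) x x)) x x) x x (b 294 x x x x))) x)) x x) x)) x) x x) (b 125 (b 222 x (b 124 x x x (b
  294 x x (b 111 x x x (b 39 (b 243 (b 105 x (b 251 x (b 262 x (b 279 x (b 172 x x x (b 207 x x x (b
  98 (b 155 x x (b 152 x x (b 255 x x x (b 203 (b 23 x x x x) x x x)) x) x) x x x))) x x) x x) x x)
  x x) x x (b 148 x x x x)) x x (b 194 x x x x))) x)) x (b 270 x x (b 82 (b 275 x x x (b 90 x x x
  x)) (b 255 x x (b 203 (b 142 (b 202 x x x (b 161 x x (b 192 x x x x) x)) x x x) x x x) x) x x) x))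
  x x x))) x) x x (b 268 x (b 174 (b 38 (b 127 x x x (b 147 (b 291 (b 39 x x (b 60 x x x (b 161 x x
  (b 308 x x x (b 96 x x x x)) (b 158 (b 98 x (b 107 (b 150 x (b 45 x x (b 279 (b 192 x (b 96 x x (b
  195 x x x x) x) x x) x x x) x) x x) x x x) x x) (b 162 x (b 59 x x x (b 107 x x x (b 241 x (b 31 x
  x x x) x x))) x x) x x))) x) x x x) (b 169 x (b 152 x (b 160 (b 166 x (b 93 x x x x) x x) x x x) x
  (b 160 x x (b 23 x x x x) x)) x x) x x)) x x x) x (b 294 x (b 295 x x x (b 153 x (b 260 x (b 152 x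
  (b 243 x x (b 79 x x x (b 246 x x (b 303 x (b 138 x x (b 192 x x x x) x) x x) x)) x) x (b 61 (b 23
  x x (b 89 x x x x) x) x x x)) x x) (b 145 x x x (b 146 (b 152 x x x x) x x x)) x)) x x) (b 222 (b
  116 x (b 260 x (b 66 x x (b 180 x x (b 290 x x (b 258 (b 161 x x (b 211 x (b 155 x (b 23 (b 6 x x
  x x) x x (b 72 x x x (b 244 x x x (b 241 x (b 152 x x x x) x x)))) (b 199 (b 88 x x x (b 64 x x x
  x)) x x (b 61 x x (b 34 x x x (b 90 x x x x)) x)) x) x x) x) x x x) x) x) x) x x) x x) x x x)) (b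
  180 (b 112 (b 122 (b 158 x x (b 290 x x x (b 111 x x x (b 177 x x x x))) x) x x x) x x x) x (b 122
  x x (b 222 x (b 112 (b 116 x x (b 239 x (b 204 x x x x) x x) (b 287 x (b 269 (b 294 x x x (b 242
  (b 115 x x x (b 163 (b 156 x x (b 101 x x (b 206 x (b 249 x (b 303 x x x (b 199 x (b 89 x x x x) x
  x)) x x) (b 152 x (b 89 x x x x) x (b 31 x x x (b 90 x x (b 89 (b 107 x x x x) x x x) x))) x) x)
  x) x x x)) (b 252 x (b 108 x x (b 295 x x x (b 291 x x (b 211 x (b 145 x x (b 104 x x x (b 95 x x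
  (b 30 x (b 165 x x (b 106 (b 189 (b 152 x x x x) x x x) x x (b 192 x x x x)) x) x x) x)) x) x x)
  x)) x) x x) x x)) x (b 37 x x x (b 74 (b 213 x x x x) (b 115 (b 257 (b 159 x (b 161 x x (b 106 (b
  298 x x (b 97 x (b 311 x x x (b 295 x x (b 192 x x x x) (b 156 x x x (b 204 x (b 250 x x (b 291 (b
  152 x x x x) x (b 223 x x x (b 192 x (b 230 x x x (b 140 x x x (b 98 x x x x))) (b 27 x (b 152 (b
  90 (b 233 x x x x) x x x) (b 59 x x x x) x (b 155 x (b 207 x x x x) x x)) x x) x)) x) x) x x)))) x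
  x) x) x x x) x) x x) x x x) x (b 108 (b 89 x x x x) x x x) (b 290 x x (b 106 (b 76 (b 123 x x (b
  225 (b 242 x (b 291 (b 213 x x (b 189 x (b 89 x x x x) x x) x) x x x) x x) x x x) x) x x x) (b 242
  (b 213 x x x x) x x x) x x) x)) x x)) (b 257 (b 289 x x (b 74 x (b 78 x (b 296 x (b 231 (b 150 x x
  x (b 254 (b 230 x x x x) x x x)) (b 299 x x x (b 169 x x x x)) x (b 203 x x (b 192 x x x x) x)) x
  x) x x) x x) x) x x x)) (b 123 x x (b 72 x (b 107 (b 158 x x (b 115 (b 90 x x x x) x x x) x) x x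
  x) x x) x) x)) x x x) x (b 293 (b 159 x x x x) x x (b 116 x (b 223 x x (b 38 x x x x) (b 66 (b 213
  (b 211 x x (b 106 x (b 206 x x (b 152 x (b 31 x (b 214 x (b 302 x x x (b 148 x (b 57 x x x (b 79 x
  x (b 89 x x x x) (b 6 (b 168 x x x x) x (b 138 x x x x) x))) x x)) x x) x x) x (b 31 x x x (b 214
  x x x (b 195 x x x (b 158 x x x x))))) x) x x) x) x x x) x (b 38 (b 99 (b 213 (b 242 (b 250 x x x
  (b 74 x (b 314 (b 298 x x (b 152 x (b 31 x (b 214 x (b 6 (b 0 x x x x) x (b 138 x x x x) x) x x) x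
  x) x (b 31 x x x (b 214 x x x (b 57 x (b 91 x (b 155 x x x x) (b 73 (b 186 x x x x) (b 192 x x x
  x) (b 195 x x x x) x) x) x x)))) x) x x x) x x)) x x x) x x x) x (b 95 x x (b 191 x x x (b 102 (b
  34 x (b 155 x x x x) x x) x x x)) x) (b 294 x (b 306 (b 79 x x (b 241 x (b 21 (b 61 x (b 29 (b 205
  x x x x) x x x) x x) x x x) x x) x) (b 158 (b 287 x (b 146 x (b 150 x (b 34 (b 29 x (b 77 (b 100 x
  x x (b 189 x (b 214 x x x x) x x)) x x x) x x) x x x) x x) x x) x x) x x x) x x) x x)) x x x) x))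
  (b 39 x x x x) x))) (b 112 (b 116 x (b 127 x x (b 262 x (b 290 x x (b 106 x (b 39 x x (b 193 x (b
  111 (b 234 x x x (b 222 (b 239 x x x x) x x (b 114 (b 293 x x x x) (b 203 (b 239 x (b 293 x x (b
  150 x (b 291 (b 252 x x x (b 158 (b 27 x (b 29 x (b 34 (b 155 x x x (b 105 x x x (b 107 x x x x)))
  x x x) x x) x x) x x x)) x (b 208 x x x x) x) x x) x) x x) (b 239 (b 192 x (b 105 x (b 310 x (b
  185 (b 158 x (b 282 (b 150 (b 96 (b 34 x (b 162 x (b 168 (b 275 (b 80 x (b 163 (b 226 x x (b 155 x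
  (b 107 x x x (b 90 x x (b 152 x x x x) x)) x (b 107 x x x x)) x) x x x) x x) x x x) x x x) x x) (b
  89 x x x x) x) x x x) x x x) x x x) x x) x x x) x x) x x) x x) x x x) x x) x x))) x (b 105 x x x
  x) x) x x) x) x x) x) x x) x) (b 204 x x x x) (b 222 x (b 40 x x (b 90 x x x x) x) x x)) x (b 222
  x x x x) (b 67 x x (b 262 x (b 306 (b 100 x x (b 164 x x (b 64 x x (b 265 x (b 155 x x x x) x x)
  x) x) x) x x x) x x) x))) (b 171 x (b 125 x x (b 258 x x x (b 226 (b 81 x x x (b 74 x (b 304 x (b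
  194 x (b 38 x x x x) x x) x (b 122 (b 242 x (b 162 x x (b 212 x x x x) x) x x) x (b 37 x x x (b 78
  (b 152 x x x x) (b 290 (b 293 x x x x) x (b 97 x (b 252 x (b 153 x x (b 152 x x x x) x) x x) x x)
  x) x x)) x)) x x)) x x x)) (b 269 x x x (b 181 x x (b 70 x x (b 304 x x x (b 290 x x x (b 250 x (b
  167 x x (b 106 (b 83 x (b 249 x x x x) x x) (b 172 (b 191 x x (b 57 x x x (b 155 x x x x)) x) x x
  x) (b 261 (b 213 x x x (b 256 (b 163 x x x (b 285 (b 99 (b 89 (b 47 (b 131 (b 0 x x (b 53 x x x x)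
  x) x x x) x x x) x x (b 23 x x x x)) x x (b 188 x x x x)) x x x)) x x x)) x x (b 191 x x (b 249 x
  (b 210 x x (b 281 (b 279 x x x (b 105 x x x (b 155 x x x (b 57 x x x (b 21 x x x x))))) x x x) x)
  x x) x)) x) (b 189 x x x x)) x (b 151 (b 165 x x x (b 204 (b 159 x (b 161 x (b 300 (b 158 x x x x)
  x x x) x (b 258 (b 100 x (b 274 x x x x) (b 107 x x x x) x) x (b 192 x (b 275 x x (b 189 x (b 128
  x x x (b 89 (b 24 x x x x) x x x)) x x) (b 152 x (b 100 x x x (b 212 x x x x)) (b 195 x x x x) x))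
  (b 109 x x x (b 155 x (b 107 x x x x) (b 29 (b 31 x x x x) x x x) (b 158 x x x x))) x) x)) x x) x
  (b 189 (b 192 x x x x) (b 21 (b 89 x (b 18 x x x x) x x) x x (b 89 (b 131 x x x (b 188 x x x x))
  (b 188 x x (b 18 x x x (b 90 x x x x)) x) x x)) (b 172 x x x (b 100 x x x (b 192 x x x (b 17 x x x
  x)))) x) x)) x x x)))) x) x))) x x)) x))

set_option maxHeartbeats 0 in
theorem refutesFrom_searchTree₁ :
    refutesFrom [(221, 1), (292, 0), (22, 0), (119, 1), (220, 2)]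
      searchTree₁ = true := by
  decide +kernel

/-- A search for colourings in which vertex `221` has colour `2`. -/
noncomputable def searchTree₂ : SearchTree :=
  b 173 (b 259 x (b 116 (b 172 x (b 224 x x x x) x x) (b 172 (b 122 x x x (b 219 x (b 257 x x x (b
  70 x x x (b 262 x x x (b 74 x (b 145 x x (b 211 x (b 206 (b 99 (b 100 x x x x) x x x) x x x) x x)
  x) x x)))) x x)) x x x) (b 225 (b 38 x x x (b 103 x (b 155 x x x x) (b 261 x x (b 70 (b 300 x x x
  (b 175 x x (b 171 x x x x) (b 258 x (b 228 x x (b 158 x (b 122 x (b 213 (b 64 x x (b 153 x (b 98 x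
  x x (b 195 x (b 203 x x x (b 214 x x x (b 192 x (b 159 x x (b 5 x (b 39 (b 189 x x x (b 152 x x x
  x)) x x x) x x) x) x x))) x x)) x x) x) x x x) x x) x x) x) x x))) x x x) (b 150 x x x (b 274 x x
  (b 189 x x x x) x))) x)) (b 291 x x x (b 79 (b 98 x x x x) x (b 39 x (b 122 x (b 223 x x x (b 293
  (b 301 x x x (b 76 x (b 152 x x x x) x x)) x x x)) x (b 265 (b 294 x x (b 98 x x (b 205 x x x x)
  x) x) x x x)) x (b 158 x x x x)) x)) x (b 291 x x x (b 293 (b 213 (b 98 x x x x) (b 283 x (b 246 x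
  x x (b 214 (b 203 x x x x) x x x)) x x) x x) x x x))) (b 71 x x x (b 291 (b 98 x x x x) x (b 179
  (b 222 x (b 246 x x x (b 145 x (b 283 x (b 192 x x x x) x x) x x)) x x) x x (b 222 (b 304 x (b 79
  x x (b 293 (b 295 x x x (b 294 x x (b 248 x x (b 107 (b 168 (b 269 x x x (b 96 (b 81 x x x (b 90 x
  x x x)) x x x)) x x x) x x x) x) x)) x x x) x) x x) (b 122 (b 155 x x x x) (b 114 (b 75 x x x (b
  39 (b 223 x x (b 158 x x x x) (b 164 (b 155 x (b 98 x x (b 294 x x (b 34 (b 3 x x x (b 290 x (b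
  192 x x x x) x x)) x x x) x) x) x x) (b 65 x x (b 192 x x (b 86 x x x x) x) x) x (b 251 x x (b 239
  (b 229 x (b 286 (b 240 (b 53 x x x x) x x (b 195 x (b 199 (b 93 (b 99 x x x (b 230 x x x x)) x x
  x) x x x) x x)) x x x) x x) x x x) x))) x (b 105 x x x x) x)) x x x) x x) x x)) x))) x (b 225 (b
  222 x x (b 177 x x x (b 125 x x (b 287 x x (b 178 x x x (b 82 (b 41 x (b 152 x x x (b 105 x x (b
  205 x x x (b 158 x x x x)) x)) x x) (b 41 x (b 295 x x x (b 35 x x x x)) x x) x x)) x) x)) (b 116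
  (b 112 x x x (b 267 x (b 268 x (b 171 x (b 126 (b 295 x x x x) x x (b 181 x (b 100 x x x x) (b 70
  (b 152 (b 205 x x x x) x x x) x (b 265 (b 38 (b 302 x x x (b 158 x x x x)) (b 74 x x x (b 269 (b
  261 (b 298 x (b 155 x x x x) x x) x (b 228 (b 155 x x (b 158 x (b 152 x x x x) x x) x) x x (b 106
  x x x x)) x) (b 304 x x x x) x x)) x (b 151 x x (b 124 x (b 105 x x x (b 262 x x (b 155 x x x x)
  x)) (b 110 x x x (b 219 (b 106 x x (b 256 x x (b 153 x x x x) x) x) (b 155 x x x x) x x)) x) x))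
  (b 219 x x (b 105 x x x x) x) x x) x) x)) x (b 232 x x x x)) (b 250 x x x x) x) x x)) (b 261 x x
  (b 66 (b 249 x x (b 195 x x x x) x) x (b 264 (b 100 (b 175 x (b 231 x (b 61 x (b 103 x x (b 31 x x
  (b 152 (b 212 x x x (b 105 x x x (b 284 x x x x))) x x x) x) x) x x) x x) x x) x x x) x x x) x) x)
  (b 258 x x x (b 170 x (b 181 x (b 155 x x (b 71 x x x x) x) (b 124 x (b 78 x (b 293 x x x (b 297 x
  (b 201 x x x x) x x)) x (b 106 x x (b 193 x x (b 110 x x x (b 39 (b 206 x x x x) (b 122 (b 257 x x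
  x (b 313 (b 262 x (b 100 x x x x) x x) x x x)) (b 257 x x x (b 301 (b 242 x x x (b 280 x x (b 205
  (b 59 x x x x) (b 47 x x x x) x x) x)) (b 31 x x x x) x (b 212 x x (b 100 x x x x) x))) x (b 107 x
  x x (b 115 x x x (b 192 x x x x)))) x x)) x) (b 71 x x x x))) x x) x) x x)) x)) (b 265 (b 177 (b
  150 x x (b 78 (b 152 x x x x) x x x) x) x x x) (b 116 x x (b 297 x (b 261 x x x (b 38 x x x (b 81
  x x x (b 75 x x x (b 113 (b 124 x x x (b 289 x x x (b 223 x x x (b 313 x x x (b 219 x (b 79 (b 159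
  x (b 163 x (b 294 x x (b 153 (b 195 x x (b 161 x (b 21 x x (b 203 x x x x) x) x x) x) x (b 155 x
  (b 105 (b 31 x x x x) x x (b 88 x x x x)) (b 158 x (b 105 x x (b 205 x x x x) x) (b 274 x x x x)
  x) x) x) x) x x) x x) x (b 78 (b 97 x x (b 109 x x (b 31 (b 158 x x x x) x x x) (b 195 x x (b 98 x
  x x x) x)) x) (b 181 x x (b 253 x x x (b 275 x x (b 90 x x x x) x)) (b 249 (b 98 x x (b 205 x x x
  x) x) (b 155 x x x x) (b 98 x (b 150 (b 89 x x x x) x x x) x x) x)) x x) x) (b 165 x x x (b 106 (b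
  212 x x x x) (b 195 x x (b 232 x x (b 90 x x x x) x) x) x x)) x))))) x x x))))) x x) x) x (b 116 x
  (b 251 x x (b 158 x x x x) x) x x)) x (b 116 x x (b 291 x x x (b 74 x x (b 39 x (b 223 x x x (b
  270 (b 38 x x x (b 82 (b 150 x x x x) x (b 294 x x (b 153 x (b 165 (b 169 x x (b 301 (b 105 x x (b
  205 x x x x) (b 158 x (b 212 x x x x) x (b 253 x x x (b 98 x x (b 176 (b 21 x x x x) x x x) x))))
  x x (b 214 x x x x)) (b 212 x x x x)) x x x) x x) x) x)) x x x)) x x) x)) x))) x x (b 259 x (b 225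
  (b 122 x (b 222 x (b 287 x x x (b 116 x x x (b 223 x x x (b 314 (b 175 x x x (b 39 (b 181 x x x (b
  37 x x x (b 294 x x (b 311 x x x (b 59 x x x x)) (b 257 (b 258 (b 264 (b 265 x (b 112 (b 153 (b
  101 x x x (b 162 (b 89 x x x x) (b 310 x (b 79 (b 249 x x (b 212 (b 144 x (b 91 x x x (b 90 x x x
  x)) x x) x x x) x) x (b 155 x x x x) x) x x) (b 108 (b 88 x x x (b 267 x (b 192 x (b 203 x x (b 59
  (b 230 x x x (b 90 x x x x)) x x x) x) (b 128 x x x x) x) x x)) x x x) x)) (b 106 x x (b 283 x x x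
  (b 213 (b 164 (b 158 x x x x) x x x) x x x)) x) x x) x (b 191 x (b 103 x x (b 249 x x (b 162 x (b
  79 (b 267 x (b 262 x (b 310 x (b 61 (b 155 x x x x) x x (b 284 (b 160 x (b 98 (b 210 x x (b 84 (b
  164 x (b 300 x x (b 279 x (b 153 (b 209 x x x (b 185 (b 131 x x x x) x x x)) (b 138 (b 273 x x (b
  86 x x x x) x) x x x) x x) x x) x) (b 81 x x x x) x) x x x) x) x x x) x x) x x x)) x x) x x) x x)
  x (b 109 x x (b 30 x x (b 90 x x x x) x) x) x) x x) x) x) (b 155 x (b 203 x x (b 100 x (b 212 x x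
  x (b 289 x x (b 296 x x x (b 78 x (b 71 x x (b 59 (b 142 x x (b 90 x x x x) x) x x x) (b 69 x (b
  142 (b 89 x x x x) x x x) x x)) x x)) x)) x x) x) x x) (b 246 x x (b 158 x x x (b 101 x x x (b 89
  x x x x))) x)) x) x (b 167 x x x x)) x x x) x x x) x x x)))) x x x)) x x x)))) x (b 279 x x x x))
  x (b 219 x x x x)) (b 222 x x (b 265 x x x (b 171 x x x (b 112 x x (b 125 x x x (b 266 x x x (b
  172 x x x (b 74 (b 36 x (b 97 x x (b 153 x x x (b 202 (b 95 x x (b 305 x (b 148 x (b 155 x x x (b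
  103 x (b 116 x x x x) x x)) x x) x x) x) x x x)) x) x x) (b 111 x x (b 155 x x x (b 98 x x (b 228
  x x (b 158 x x x (b 284 (b 97 x x x x) x x x)) x) x)) x) x x)))) x))) (b 116 (b 125 x x x (b 260 x
  (b 113 (b 314 (b 105 x x x x) x x x) x x (b 175 x (b 212 x x x x) (b 79 (b 226 (b 99 x x x (b 286
  x (b 212 x x x x) x x)) x x x) x (b 177 x (b 38 (b 265 x x x x) (b 262 (b 305 x (b 156 x x x x) x
  x) x x x) x (b 290 (b 293 x x x x) (b 29 (b 266 x x x (b 219 (b 251 x x x x) (b 152 x x x (b 314 x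
  x x x)) x x)) x x x) x (b 155 x x x x))) x (b 293 x x x x)) x) x)) x x)) (b 172 x x x (b 260 x (b
  287 x x x (b 226 (b 124 x x x (b 257 (b 108 (b 95 x x (b 115 (b 122 (b 242 x (b 219 (b 212 x x x
  x) (b 145 (b 213 x x x x) (b 158 x x (b 75 x x (b 284 x x x x) x) x) (b 239 x x x (b 284 x x x x))
  x) x x) x x) x x (b 145 x (b 212 (b 90 x x x x) x (b 293 (b 284 (b 152 x x x (b 59 x x x x)) x x
  x) x x x) x) x x)) x x x) x) x x x) (b 158 x x x x) x x)) (b 294 x x x x) x x)) x x)) (b 265 x x x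
  (b 180 (b 266 x x x (b 261 (b 219 x (b 39 (b 207 x x (b 158 x x x x) x) (b 74 x x (b 224 (b 122 (b
  40 (b 284 x x x (b 205 x x x x)) x x x) (b 255 x (b 152 x x x x) x x) x (b 115 x x x (b 38 x (b
  159 x x x (b 192 x x x x)) x x))) (b 159 x x x (b 153 x x x x)) x x) x) x x) (b 39 x x x x) x) (b
  39 x x x x) x x)) x x x)) x)) x (b 291 x x (b 116 x x x (b 39 (b 182 x x (b 66 (b 165 (b 143 (b
  250 (b 38 x x x (b 286 x x x (b 169 x x (b 290 (b 310 x x (b 109 x x x x) x) (b 152 (b 107 x (b 98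
  (b 160 x (b 284 (b 192 x (b 109 x x x (b 189 x x x x)) x x) x x x) x x) x x x) x x) (b 241 (b 98 x
  x (b 61 x x (b 146 x x x x) x) x) x x x) x x) x x) x))) x x x) x x x) (b 283 x (b 95 x x (b 38 x x
  x (b 192 x (b 17 x x (b 90 (b 152 x x x x) (b 45 x (b 144 (b 240 (b 185 x x x x) x x x) x x x) x
  x) x x) (b 90 (b 195 x x x x) x x x)) (b 90 (b 21 x (b 195 x x x x) x x) (b 189 x x x x) x (b 89 x
  x x x)) x)) x) x x) x x) x x x) x) x x x)) x)) x (b 70 (b 171 (b 180 x x (b 165 x (b 226 (b 30 x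
  (b 192 x (b 90 (b 100 x (b 130 x x (b 275 x (b 230 x x (b 207 x x x x) x) x x) x) x x) (b 149 (b
  189 x x (b 140 x x (b 152 x (b 89 x x x (b 240 (b 47 x x (b 138 x x x x) x) x x x)) x x) x) (b 89
  x x x x)) x x x) x (b 87 x x x x)) (b 205 x (b 214 (b 284 x x (b 31 x x x x) x) x x x) (b 31 x x x
  x) x) x) x x) x x x) x x) x) (b 176 x x (b 204 (b 165 x (b 108 (b 192 x (b 26 x x (b 149 (b 90 (b
  89 (b 274 x x x x) x x x) (b 189 x x (b 131 x x x (b 152 x (b 141 x x x (b 274 x x (b 59 x x x x)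
  x)) x x)) x) x x) x x x) (b 90 (b 45 x x (b 24 x x x x) x) (b 89 x x x (b 189 x x x x)) x (b 232 x
  x x x))) (b 89 x (b 26 x x x x) x (b 90 (b 140 x x x x) (b 189 x x x x) x x)) x) x x x) x x) x x
  x) x) x (b 116 x (b 38 x (b 177 (b 222 (b 265 x x x x) x x (b 293 (b 280 (b 212 (b 90 x x x x) x
  (b 248 (b 249 (b 195 x x x (b 138 x x x x)) x x x) x x x) x) x x x) x x x)) x x (b 284 x x x x)) x
  x) x x)) x (b 177 (b 225 (b 176 (b 265 (b 293 x x x x) (b 222 x (b 40 x x (b 78 x (b 175 x x x (b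
  314 (b 295 x x x (b 36 x (b 153 (b 213 x (b 38 x x x (b 211 x x x (b 239 (b 90 x x x x) (b 88 x x
  x (b 269 x x (b 192 x (b 203 x x (b 249 x (b 158 x x (b 100 x (b 34 x x (b 189 x x (b 306 x x x x)
  (b 89 x x x x)) x) x x) x) x x) x) (b 155 x x x x) x) (b 246 x x (b 207 (b 158 x x x x) x x x)
  x))) (b 203 x (b 249 x x (b 158 x (b 100 x x (b 34 x (b 64 x x (b 144 (b 155 x x x x) x x (b 98 x
  x x x)) x) x x) x) x x) x) x x) x))) x x) (b 59 x x x x) x x) x x)) x x x)) x x) x) x (b 293 x (b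
  100 x x x x) x x)) x x) x x x) (b 258 (b 257 (b 115 (b 291 x x (b 223 x x x (b 174 x x (b 74 x x
  (b 95 x x (b 181 x (b 234 (b 240 (b 189 x (b 29 x x x x) x x) x x x) x x x) x x) x) x) x)) (b 82 x
  x (b 75 (b 223 x x (b 107 x (b 100 (b 109 x (b 152 x x x x) x x) x x x) x x) (b 114 x x (b 298 x x
  x (b 97 x x (b 153 x x x x) (b 108 (b 190 x (b 138 x x (b 23 x x x x) (b 34 x (b 105 x x x x) x
  x)) (b 167 x x (b 79 x x (b 182 (b 156 x (b 275 x x (b 189 x x x x) x) x (b 125 (b 266 (b 204 x (b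
  231 (b 109 x x x x) x x x) (b 158 x x x x) x) x x x) x x (b 234 x x x (b 228 (b 100 (b 29 x x (b
  306 x x (b 158 x (b 96 x x x x) x (b 192 x x x (b 212 x (b 90 x x x x) (b 253 x (b 98 x x (b 90 x
  x x x) x) x (b 90 x x x (b 247 x x x x))) x))) x) x) x x x) x (b 109 x (b 251 x x x x) x x) x))))
  x x x) x) x) x) x (b 192 x (b 161 x x x (b 93 (b 132 x x x (b 87 x x x x)) x x x)) (b 31 (b 155 x
  (b 107 x x x x) (b 105 (b 158 x x x x) x (b 23 x x x x) x) x) x x x) x) x))) (b 283 (b 231 x x x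
  x) x x x))) x x x) x)) x x (b 212 x x x x)) x x x) x x x) x (b 116 x (b 226 x (b 287 x (b 291 x x
  (b 183 (b 256 x (b 193 x (b 265 x x x x) x x) x x) (b 290 x x x x) x x) (b 212 x x x x)) x x) x x)
  (b 265 x (b 305 x x x (b 38 x (b 204 x (b 298 x (b 290 x (b 100 (b 115 (b 29 x x (b 158 x (b 152 x
  x x x) x (b 280 (b 268 x (b 152 x x x x) (b 54 x x x (b 72 x x x (b 152 x (b 253 x (b 17 x x x x)
  x x) x x))) x) x x x)) x) x x x) x (b 96 x (b 152 x x x x) x x) x) x x) x x) x x) x (b 183 x (b 84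
  x x x (b 204 (b 79 (b 74 x x (b 283 (b 151 x (b 293 (b 240 x x x x) x x x) x x) (b 206 x x x (b
  234 (b 169 (b 30 x (b 99 x (b 145 x x x (b 175 (b 152 x x x x) x x (b 289 x x (b 311 (b 231 (b 192
  x (b 100 x (b 31 x (b 152 x (b 160 (b 64 x (b 230 x x x (b 90 x (b 89 x x x x) x x)) x x) x x x) x
  x) x x) x x) x x) (b 274 x (b 181 x x x (b 144 x x x (b 105 x x (b 232 x x x x) x))) x x) x x) x x
  x) x))) x x) x x) x x x) x x x)) x x) x) x x x) x (b 275 x x (b 90 x x x x) x) x)) x x))) x x) (b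
  222 (b 291 x x (b 286 x x x (b 264 x x x (b 122 x (b 41 x x (b 42 (b 243 (b 36 (b 192 x (b 233 x x
  x (b 133 x x x x)) x x) x x x) (b 168 x x (b 107 (b 89 x x x x) x x x) x) x x) x x x) x) x (b 71
  (b 103 x x (b 152 x x x (b 158 x (b 31 x x (b 168 (b 302 x x (b 105 x x x x) x) x x x) x) x x)) x)
  x x (b 212 x x x x))))) x) (b 287 x (b 122 (b 252 x x x x) (b 39 (b 127 (b 291 (b 106 x x x x) x
  (b 294 x x (b 106 x x (b 290 x (b 231 (b 71 x x x (b 31 x (b 168 x x (b 107 (b 89 x x x x) x x x)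
  x) x x)) (b 152 (b 192 x (b 233 x x x (b 105 x x (b 203 x x x x) x)) x x) x x x) x x) x x) x) (b
  213 x (b 280 (b 95 x x (b 106 (b 192 x (b 108 (b 238 x x (b 26 x x (b 90 (b 135 x x x x) (b 275 (b
  89 x x x (b 132 x x (b 241 x x (b 64 x (b 262 x x x x) x x) x) x)) x x x) x x) (b 90 (b 100 x (b
  28 x x (b 89 x x x x) x) x x) (b 89 x x x (b 189 x x x x)) x (b 89 x x x x))) x) x (b 21 x x x (b
  152 x (b 87 x x x (b 233 x x x x)) x x)) x) (b 90 (b 94 x x (b 89 x x x x) x) (b 189 x x x x) x (b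
  89 x x x x)) x) x x (b 157 x x x x)) x) x x x) x x)) x) x x x) x x x) x (b 250 x x x x)) (b 122 x
  x x x) x) x x))) (b 265 x (b 66 x (b 297 x (b 204 (b 178 x (b 159 x (b 260 x x (b 212 x x x x) (b
  39 (b 155 x x x x) x x x)) x x) x x) x x x) x x) x x) x x) x (b 296 x x (b 222 (b 224 (b 82 x x (b
  240 x x x x) x) x x x) (b 78 (b 106 x x x x) x x x) x (b 122 x (b 106 x x (b 213 (b 151 x x (b 270
  (b 242 x x x (b 280 x x (b 161 x (b 189 x x (b 244 x x (b 185 (b 139 x x x (b 241 x (b 23 x x x (b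
  89 x x x x)) x x)) x x x) x) (b 85 x x (b 241 x x x x) x)) (b 244 x x x x) x) x)) (b 239 x (b 152
  x x x x) x x) x x) x) x x x) x) x x)) (b 242 x x x (b 280 x x (b 151 x x (b 161 x (b 189 x x (b
  244 x x (b 185 (b 139 x x x (b 241 x (b 214 x x x (b 195 x x x x)) x x)) x x x) x) (b 61 x x (b 89
  x x x x) x)) (b 152 x x x x) x) x) x)))) x))

set_option maxHeartbeats 0 in
theorem refutesFrom_searchTree₂ :
    refutesFrom [(221, 2), (292, 0), (22, 0), (119, 1), (220, 2)]
      searchTree₂ = true := by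
  decide +kernel

/-- A search for colourings in which vertex `221` has colour `3`. -/
noncomputable def searchTree₃ : SearchTree :=
  b 173 (b 259 x (b 260 x (b 291 x (b 178 x (b 108 x (b 165 x (b 159 x x x (b 145 (b 161 (b 294 x x
  (b 243 x (b 281 x x (b 158 x x x x) x) x x) x) x x x) x x x)) x x) x x) x x) (b 222 x x x x) (b
  217 x (b 175 x x x (b 269 x x x (b 125 (b 177 x (b 288 x x x (b 122 (b 290 x (b 249 x x x x) x x)
  x (b 158 x x (b 105 (b 212 x x x x) x x x) x) x)) x x) x x (b 249 x x x x)))) x x)) x (b 116 (b 60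
  (b 156 x x x (b 108 x x x (b 96 x (b 252 x x x x) x x))) x x x) x (b 181 (b 81 x x x x) x x x) (b
  170 x x x (b 125 (b 258 x (b 222 x (b 81 x x x (b 291 x x (b 39 (b 122 (b 42 x x x (b 114 x (b 155
  x (b 239 x x (b 152 x x x x) x) (b 108 x x x (b 158 (b 57 x x x x) x x x)) (b 249 x x x x)) x x))
  (b 152 x x x x) x x) x x x) x)) x x) x x) x x x)))) (b 222 (b 172 x (b 116 x x x x) (b 122 x x x
  x) x) x (b 258 x x (b 178 x x (b 112 x x (b 177 (b 174 (b 268 x (b 226 x (b 38 (b 270 (b 201 x x x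
  x) x x x) (b 76 x x (b 81 x x x (b 223 x x x (b 146 x x x (b 82 x (b 152 x x x x) x x)))) x) (b
  159 x (b 152 x x x x) x x) x) x (b 153 x x x x)) x x) x x x) x x (b 125 x x x (b 116 (b 266 (b 174
  (b 82 (b 155 x x x x) (b 175 x (b 70 x x x (b 297 x x x (b 113 x x x (b 122 (b 79 (b 219 (b 38 x
  (b 231 (b 262 x x x x) x x x) (b 231 (b 308 x x (b 304 x x x x) x) x x x) x) x x (b 213 x x x x))
  x x x) x (b 152 x x x x) x)))) x x) x (b 122 (b 74 x x (b 219 (b 294 (b 108 x x x x) (b 262 x x x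
  (b 155 x x x x)) x (b 161 x (b 283 (b 204 x (b 153 x x x x) x x) x x x) x x)) x x (b 155 x x x x))
  x) (b 41 x x x (b 106 x x x (b 159 (b 308 x x (b 254 x x x x) x) x x x))) (b 67 x x x (b 304 x (b
  38 (b 239 (b 106 x x x x) x x x) x x x) (b 153 x (b 293 x (b 155 x x x x) x x) x x) (b 212 x x x
  x))) x)) x x x) x x x) (b 228 (b 155 x x x x) x x x) x x))) x) x) x) (b 177 x x x (b 116 (b 265 (b
  293 (b 152 x x (b 176 (b 181 x x (b 155 x x x (b 301 x x x x)) x) x x x) x) (b 155 x x x x) x x) x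
  x x) (b 224 (b 111 x x x (b 67 x x x (b 39 (b 204 x x x x) x (b 243 x x x (b 38 x x (b 162 x (b
  212 x x x x) x x) x)) x))) x x x) x x))) x) x (b 224 (b 225 (b 217 x (b 81 x x x x) x x) (b 218 (b
  172 x x (b 259 x (b 258 (b 180 (b 125 x x (b 260 x (b 177 x (b 222 x x (b 116 (b 74 (b 290 x x x
  x) (b 226 (b 79 x x x (b 126 x x x (b 70 (b 122 (b 161 x x (b 76 x (b 205 x (b 105 x x x x) x x)
  (b 249 x (b 214 x x x (b 56 x x x x)) x x) (b 153 x x x x)) x) x x x) x (b 291 x x x x) x))) x x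
  x) x (b 122 (b 262 (b 70 (b 164 (b 294 (b 251 (b 107 x x x x) x x x) x x x) (b 155 x x x x) x (b
  155 x x x x)) x (b 155 x x x x) x) x x x) (b 158 (b 242 x x x (b 280 (b 70 x x x x) x x x)) x x x)
  (b 212 (b 78 x x x (b 152 (b 107 x x x x) x x (b 205 x x x x))) x x x) x)) x x (b 219 x (b 262 (b
  38 (b 294 x x x x) (b 295 x x (b 239 x x x (b 249 x (b 98 x x x x) x x)) x) x x) x x x) x x)) (b
  122 (b 152 x x x x) (b 223 x x (b 39 x (b 298 (b 213 x x x x) x x x) x x) x) x x)) x x) x x) x) x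
  x x) x x x) x x) x) x x x) (b 259 x x (b 78 (b 124 (b 177 x (b 79 (b 222 (b 212 x x x x) (b 71 x x
  x (b 162 x x (b 103 (b 39 (b 155 x x x (b 203 (b 154 x x x (b 107 (b 205 x (b 284 x x x x) x x) x
  x x)) x x x)) x x x) x x x) x)) x x) x x x) x x) x x x) x x (b 105 x x (b 191 x (b 213 x x x x) x
  x) x)) x) x) (b 180 (b 268 x (b 116 x x x x) (b 291 (b 146 x (b 116 x (b 71 (b 158 x x (b 100 x x
  x (b 216 x x x (b 301 x x (b 203 x x x x) x))) x) x x x) x x) x x) x x x) (b 291 (b 158 x x (b 203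
  x x x x) x) x x x)) x x (b 287 x (b 67 (b 192 x x x x) x x (b 116 x x (b 111 x x x (b 264 x x x (b
  222 (b 190 x x x (b 293 x (b 100 x (b 249 x x (b 122 x x x x) x) x x) x x)) x x x))) x)) (b 116 x
  x x x) (b 222 (b 122 x x x x) x x x))) x x) x

set_option maxHeartbeats 0 in
theorem refutesFrom_searchTree₃ :
    refutesFrom [(221, 3), (292, 0), (22, 0), (119, 1), (220, 2)]
      searchTree₃ = true := by
  decide +kernel

/-- Vertices `292` and `22` have different colours: a colouring in which they agree could be
renamed to have the colours `0`, `1`, `2` on the triangle `292`, `119`, `220`. -/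
theorem apply_ne_of_forall_mem_edges {col : ℕ → Fin 4} (hcol : ∀ e ∈ edges, col e.1 ≠ col e.2) :
    col 292 ≠ col 22 := by
  intro hPQ
  have hX : col 119 ≠ col 292 := hcol (119, 292) (by decide +kernel)
  have hY : col 220 ≠ col 292 := hcol (220, 292) (by decide +kernel)
  have hXY : col 119 ≠ col 220 := hcol (119, 220) (by decide +kernel)
  obtain ⟨f, hf, h0, h1, h2⟩ : ∃ f : Fin 4 → Fin 4, Function.Injective f ∧ f (col 292) = 0 ∧
      f (col 119) = 1 ∧ f (col 220) = 2 := by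
    generalize col 292 = x, col 119 = y, col 220 = z at hX hY hXY
    refine ⟨fun t => if t = x then 0 else if t = y then 1 else if t = z then 2 else 3, ?_⟩
    revert x y z
    decide
  have hfcol : ∀ e ∈ edges, f (col e.1) ≠ f (col e.2) := fun e he h => hcol e he (hf h)
  have key (t : SearchTree) (k : ℕ) (hk : (f (col 221) : ℕ) = k)
      (ht : refutesFrom [(221, k), (292, 0), (22, 0), (119, 1), (220, 2)] t = true) : False := by
    refine Bool.false_ne_true ((refutesFrom_eq_false (col := fun v => f (col v)) hfcol
      (fun p hp => ?_) t).symm.trans ht)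
    simp only [List.mem_cons, List.not_mem_nil, or_false] at hp
    rcases hp with rfl | rfl | rfl | rfl | rfl
    · exact hk
    · exact congrArg Fin.val h0
    · exact congrArg Fin.val (hPQ ▸ h0)
    · exact congrArg Fin.val h1
    · exact congrArg Fin.val h2
  have hR : f (col 221) = 0 ∨ f (col 221) = 1 ∨ f (col 221) = 2 ∨ f (col 221) = 3 := by
    generalize f (col 221) = x
    revert x
    decide
  rcases hR with h | h | h | h
  · exact key _ 0 (congrArg Fin.val h) refutesFrom_searchTree₀
  · exact key _ 1 (congrArg Fin.val h) refutesFrom_searchTree₁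
  · exact key _ 2 (congrArg Fin.val h) refutesFrom_searchTree₂
  · exact key _ 3 (congrArg Fin.val h) refutesFrom_searchTree₃

/-! ### The point set -/

noncomputable def pt (v : ℕ) : EuclideanSpace ℝ (Fin 2) := toPlane (points.getD v 0)

theorem pt_injective : Function.Injective fun v : Fin 315 => pt v := by
  have hl : points.length = 315 := by decide +kernel
  have hn : points.Nodup := by decide +kernel
  intro v w h
  have h := toPlane_injective h
  rw [List.getD_eq_getElem _ _ (by omega), List.getD_eq_getElem _ _ (by omega)] at h
  exact Fin.ext ((hn.getElem_inj_iff).1 h)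

theorem dist_pt_of_mem_edges {e : ℕ × ℕ} (he : e ∈ edges) : dist (pt e.1) (pt e.2) = 1 := by
  have h : ∀ e ∈ edges, IsUnitVector (points.getD e.1 0 - points.getD e.2 0) := by
    decide +kernel
  exact (dist_toPlane_eq_one_iff _ _).2 (h e he)

theorem dist_pt_pt : dist (pt 292) (pt 22) = 5 / 3 := by
  have h := dist_toPlane_sq (points.getD 292 0) (points.getD 22 0)
  rw [show points.getD 292 0 = (26, 3, 5, 8) by decide +kernel,
    show points.getD 22 0 = (6, 13, 15, 33) by decide +kernel] at h
  have h' : dist (pt 292) (pt 22) ^ 2 = (5 / 3) ^ 2 := by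
    rw [pt, pt, show points.getD 292 0 = (26, 3, 5, 8) by decide +kernel,
      show points.getD 22 0 = (6, 13, 15, 33) by decide +kernel]
    norm_num [coordA, coordB, coordC, coordD] at h
    linarith
  exact (pow_left_inj₀ dist_nonneg (by norm_num) two_ne_zero).1 h'

/-- The set of all lattice points is 4-colourable. -/
theorem exists_coloring_range_toPlane : ∃ c : EuclideanSpace ℝ (Fin 2) → Fin 4,
    ∀ u v, dist (toPlane u) (toPlane v) = 1 → c (toPlane u) ≠ c (toPlane v) := by
  let f : ℤ × ℤ × ℤ × ℤ → ZMod 2 × ZMod 2 := fun v => (v.2.1, v.2.2.2)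
  let e : ZMod 2 × ZMod 2 ≃ Fin 4 := finProdFinEquiv
  refine ⟨fun x => e (f (Function.invFun toPlane x)), fun u v h heq => ?_⟩
  simp only [Function.leftInverse_invFun toPlane_injective u,
    Function.leftInverse_invFun toPlane_injective v, e.apply_eq_iff_eq] at heq
  simp only [f, Prod.mk.injEq] at heq
  refine not_isUnitVector_of_even (v := u - v) ?_ ?_ ((dist_toPlane_eq_one_iff u v).1 h)
  · rw [← ZMod.intCast_eq_zero_iff_even, Prod.snd_sub, Prod.fst_sub, Int.cast_sub, heq.1, sub_self]
  · rw [← ZMod.intCast_eq_zero_iff_even, Prod.snd_sub, Prod.snd_sub, Prod.snd_sub, Int.cast_sub,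
      heq.2, sub_self]

end UnitDistanceGraph

open UnitDistanceGraph in
theorem stmt_6 :
    ∃ S : Set (EuclideanSpace ℝ (Fin 2)), S.Finite ∧ S.ncard = 315 ∧
      ∃ p ∈ S, ∃ q ∈ S, dist p q = 5 / 3 ∧
        (∃ c : EuclideanSpace ℝ (Fin 2) → Fin 4, (∀ x ∈ S, ∀ y ∈ S, dist x y = 1 → c x ≠ c y)) ∧
        (∀ c : EuclideanSpace ℝ (Fin 2) → Fin 4, (∀ x ∈ S, ∀ y ∈ S, dist x y = 1 → c x ≠ c y) → c p ≠ c q) := by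
  refine ⟨Set.range fun v : Fin 315 => pt v, Set.finite_range _, ?_, pt 292, ⟨292, rfl⟩, pt 22,
    ⟨22, rfl⟩, dist_pt_pt, ?_, fun c hc => ?_⟩
  · rw [← Set.image_univ, Set.ncard_image_of_injective _ pt_injective, Set.ncard_univ,
      Nat.card_fin]
  · obtain ⟨c, hc⟩ := exists_coloring_range_toPlane
    refine ⟨c, ?_⟩
    rintro _ ⟨v, rfl⟩ _ ⟨w, rfl⟩
    exact hc _ _
  · refine apply_ne_of_forall_mem_edges (col := fun v => c (pt v)) fun e he => ?_
    obtain ⟨h1, h2⟩ := lt_of_mem_edges e he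
    exact hc _ ⟨⟨e.1, h1⟩, rfl⟩ _ ⟨⟨e.2, h2⟩, rfl⟩ (dist_pt_of_mem_edges he)
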